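/- arXiv:2104.00577 — 3 statements merged into one kernel-verified Lean document; each statement's English description precedes it below -/
import Mathlib

section
/- Let G be a unicyclic graph with cycle C, and let S ⊆ V(G) be a vertex metric generator or an edge metric generator of G. Then S is a branch-resolving set and a_S(C) ≥ 2. -/
open SimpleGraph

section Defs

variable {V : Type*}

/-- Distance from a vertex `s` to an edge `e`: the minimum of the distances to its endpoints. -/
noncomputable def edgeDist (G : SimpleGraph V) (s : V) (e : Sym2 V) : ℕ :=
  Sym2.lift ⟨fun u w => min (G.dist s u) (G.dist s w), fun u w => min_comm _ _⟩ e

/-- `S` is a vertex metric generator of `G`. -/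
def IsVertexMG (G : SimpleGraph V) (S : Set V) : Prop :=
  ∀ u v : V, u ≠ v → ∃ s ∈ S, G.dist s u ≠ G.dist s v

/-- `S` is an edge metric generator of `G`. -/
def IsEdgeMG (G : SimpleGraph V) (S : Set V) : Prop :=
  ∀ e ∈ G.edgeSet, ∀ f ∈ G.edgeSet, e ≠ f → ∃ s ∈ S, edgeDist G s e ≠ edgeDist G s f

/-- The vertex metric dimension of `G`. -/
noncomputable def metricDim (G : SimpleGraph V) : ℕ :=
  sInf {n | ∃ S : Finset V, S.card = n ∧ IsVertexMG G ↑S}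

/-- The edge metric dimension of `G`. -/
noncomputable def edgeMetricDim (G : SimpleGraph V) : ℕ :=
  sInf {n | ∃ S : Finset V, S.card = n ∧ IsEdgeMG G ↑S}

/-- `G` is unicyclic: connected, contains a cycle, and any two cycles have the same edges. -/
def IsUnicyclic (G : SimpleGraph V) : Prop :=
  G.Connected ∧ (∃ (u : V) (w : G.Walk u u), w.IsCycle) ∧
    ∀ (u u' : V) (w : G.Walk u u) (w' : G.Walk u' u'), w.IsCycle → w'.IsCycle →
      ∀ e, e ∈ w.edges ↔ e ∈ w'.edges

/-- `vc : ZMod g → V` is a labelling `v_0 v_1 ⋯ v_{g-1}` of a cycle of length `g` in `G`. -/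
def IsCycleLabelling (G : SimpleGraph V) (g : ℕ) (vc : ZMod g → V) : Prop :=
  Function.Injective vc ∧ ∀ i : ZMod g, G.Adj (vc i) (vc (i + 1))

/-- The set of edges of the cycle `C`. -/
def cycleEdges (g : ℕ) (vc : ZMod g → V) : Set (Sym2 V) :=
  {e | ∃ i : ZMod g, e = s(vc i, vc (i + 1))}

/-- The graph `G - E(C)`. -/
def offCycle (G : SimpleGraph V) (g : ℕ) (vc : ZMod g → V) : SimpleGraph V :=
  G.deleteEdges (cycleEdges g vc)

/-- `x` belongs to `T_{v_i}`, the connected component of `G - E(C)` containing `v_i`. -/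
def inTree (G : SimpleGraph V) (g : ℕ) (vc : ZMod g → V) (i : ZMod g) (x : V) : Prop :=
  (offCycle G g vc).Reachable (vc i) x

/-- The vertex `v_i` of the cycle is `S`-active: `T_{v_i}` contains a vertex of `S`. -/
def SActive (G : SimpleGraph V) (g : ℕ) (vc : ZMod g → V) (S : Set V) (i : ZMod g) : Prop :=
  ∃ s ∈ S, inTree G g vc i s

/-- `a_S(C)`: the number of `S`-active vertices on the cycle. -/
noncomputable def aS (G : SimpleGraph V) (g : ℕ) (vc : ZMod g → V) (S : Set V) : ℕ :=
  {i : ZMod g | SActive G g vc S i}.ncard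

/-- `S` is biactive: `a_S(C) ≥ 2`. -/
def Biactive (G : SimpleGraph V) (g : ℕ) (vc : ZMod g → V) (S : Set V) : Prop :=
  2 ≤ aS G g vc S

variable [Fintype V] [DecidableEq V]

/-- `t = u_1 u_2 ⋯ u_k` is a thread hanging at the vertex `v`. -/
def IsThreadAt (G : SimpleGraph V) [DecidableRel G.Adj] (v : V) (t : List V) : Prop :=
  t ≠ [] ∧ t.Nodup ∧ v ∉ t ∧ 3 ≤ G.degree v ∧ List.Chain' G.Adj t ∧
    (∀ u ∈ t.head?, G.Adj v u) ∧ (∀ u ∈ t.getLast?, G.degree u = 1) ∧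
    ∀ u ∈ t.dropLast, G.degree u = 2

/-- The thread `t` is `S`-free: it contains no vertex of `S`. -/
def SFree (S : Set V) (t : List V) : Prop := ∀ u ∈ t, u ∉ S

/-- `S` is branch-resolving: for every vertex, all threads hanging at it except possibly
one contain a vertex of `S` (i.e. at most one thread at each vertex is `S`-free). -/
def BranchResolving (G : SimpleGraph V) [DecidableRel G.Adj] (S : Set V) : Prop :=
  ∀ v : V, ∀ t₁ t₂ : List V, IsThreadAt G v t₁ → IsThreadAt G v t₂ → t₁ ≠ t₂ →
    (∃ s ∈ S, s ∈ t₁) ∨ (∃ s ∈ S, s ∈ t₂)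

/-- `ℓ(v)`: the number of threads hanging at `v`. -/
noncomputable def numThreads (G : SimpleGraph V) [DecidableRel G.Adj] (v : V) : ℕ :=
  {t : List V | IsThreadAt G v t}.ncard

/-- `L(G) = Σ (ℓ(v) - 1)` (truncated subtraction makes the sum run exactly over the
vertices with `ℓ(v) > 1`). -/
noncomputable def LG (G : SimpleGraph V) [DecidableRel G.Adj] : ℕ :=
  ∑ v : V, (numThreads G v - 1)

/-- `x` is a branching vertex of the unicyclic graph with cycle `vc`. -/
def Branching (G : SimpleGraph V) [DecidableRel G.Adj] (g : ℕ) (vc : ZMod g → V) (x : V) :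
    Prop :=
  (x ∉ Set.range vc ∧ 3 ≤ G.degree x) ∨ (x ∈ Set.range vc ∧ 4 ≤ G.degree x)

/-- The cycle vertex `v_i` is branch-active: `T_{v_i}` contains a branching vertex. -/
def BranchActive (G : SimpleGraph V) [DecidableRel G.Adj] (g : ℕ) (vc : ZMod g → V)
    (i : ZMod g) : Prop :=
  ∃ x, inTree G g vc i x ∧ Branching G g vc x

/-- `b(G)`: the number of branch-active vertices on the cycle. -/
noncomputable def bG (G : SimpleGraph V) [DecidableRel G.Adj] (g : ℕ) (vc : ZMod g → V) : ℕ :=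
  {i : ZMod g | BranchActive G g vc i}.ncard

/-- `k = max { i : v_i is S-active }` for the labelling `vc` (indices taken in `[0, g-1]`). -/
noncomputable def kOf (G : SimpleGraph V) (g : ℕ) (vc : ZMod g → V) (S : Set V) : ℕ :=
  sSup {n : ℕ | n < g ∧ SActive G g vc S (n : ZMod g)}

/-- The labelling `vc` of the cycle is canonical with respect to `S`: `v_0` is `S`-active
and `k` is as small as possible among all labellings of the cycle with `v_0` `S`-active. -/
def Canonical (G : SimpleGraph V) (g : ℕ) (vc : ZMod g → V) (S : Set V) : Prop :=
  IsCycleLabelling G g vc ∧ SActive G g vc S 0 ∧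
    ∀ vc' : ZMod g → V, IsCycleLabelling G g vc' → Set.range vc' = Set.range vc →
      SActive G g vc' S 0 → kOf G g vc S ≤ kOf G g vc' S

/-- Configuration 𝒜 : `a_S(C) = 2`, `g` even and `k = g/2`. -/
def ConfigA (G : SimpleGraph V) (g : ℕ) (vc : ZMod g → V) (S : Set V) : Prop :=
  aS G g vc S = 2 ∧ Even g ∧ kOf G g vc S = g / 2

/-- Configuration ℬ : `k ≤ ⌊g/2⌋ - 1` and an `S`-free thread hangs at `v_i` for some
`i ∈ [k, ⌊g/2⌋-1] ∪ [⌈g/2⌉+k+1, g-1] ∪ {0}`. -/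
def ConfigB (G : SimpleGraph V) [DecidableRel G.Adj] (g : ℕ) (vc : ZMod g → V) (S : Set V) :
    Prop :=
  kOf G g vc S ≤ g / 2 - 1 ∧
    ∃ i : ℕ, ((kOf G g vc S ≤ i ∧ i ≤ g / 2 - 1) ∨
        ((g + 1) / 2 + kOf G g vc S + 1 ≤ i ∧ i ≤ g - 1) ∨ i = 0) ∧
      ∃ t : List V, IsThreadAt G (vc (i : ZMod g)) t ∧ SFree S t

/-- Configuration 𝒞 : `a_S(C) = 2`, `g` even, `k ≤ g/2` and an `S`-free thread of length
`≥ g/2 - k` hangs at `v_i` for some `i ∈ [0, k]`. -/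
def ConfigC (G : SimpleGraph V) [DecidableRel G.Adj] (g : ℕ) (vc : ZMod g → V) (S : Set V) :
    Prop :=
  aS G g vc S = 2 ∧ Even g ∧ kOf G g vc S ≤ g / 2 ∧
    ∃ i : ℕ, i ≤ kOf G g vc S ∧
      ∃ t : List V, IsThreadAt G (vc (i : ZMod g)) t ∧ SFree S t ∧
        g / 2 - kOf G g vc S ≤ t.length

/-- Configuration 𝒟 : `k ≤ ⌈g/2⌉ - 1` and an `S`-free thread hangs at `v_i` for some
`i ∈ [k, ⌈g/2⌉-1] ∪ [⌊g/2⌋+k+1, g-1] ∪ {0}`. -/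
def ConfigD (G : SimpleGraph V) [DecidableRel G.Adj] (g : ℕ) (vc : ZMod g → V) (S : Set V) :
    Prop :=
  kOf G g vc S ≤ (g + 1) / 2 - 1 ∧
    ∃ i : ℕ, ((kOf G g vc S ≤ i ∧ i ≤ (g + 1) / 2 - 1) ∨
        (g / 2 + kOf G g vc S + 1 ≤ i ∧ i ≤ g - 1) ∨ i = 0) ∧
      ∃ t : List V, IsThreadAt G (vc (i : ZMod g)) t ∧ SFree S t

/-- Configuration ℰ : `a_S(C) = 2` and an `S`-free thread of length `≥ ⌊g/2⌋ - k + 1`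
hangs at `v_i` with `i ∈ [0, k]`; moreover if `g` is even an `S`-free thread hangs at
`v_j` with `j = g/2 + k - i`. -/
def ConfigE (G : SimpleGraph V) [DecidableRel G.Adj] (g : ℕ) (vc : ZMod g → V) (S : Set V) :
    Prop :=
  aS G g vc S = 2 ∧
    ∃ i : ℕ, i ≤ kOf G g vc S ∧
      (∃ t : List V, IsThreadAt G (vc (i : ZMod g)) t ∧ SFree S t ∧
        g / 2 - kOf G g vc S + 1 ≤ t.length) ∧
      (Even g → ∃ t' : List V,
        IsThreadAt G (vc ((g / 2 + kOf G g vc S - i : ℕ) : ZMod g)) t' ∧ SFree S t')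

/-- `G` contains configuration 𝒜 with respect to `S` (evaluated on a canonical labelling
of the cycle given by `vc`). -/
def ContainsA (G : SimpleGraph V) (g : ℕ) (vc : ZMod g → V) (S : Set V) : Prop :=
  ∃ vc' : ZMod g → V, IsCycleLabelling G g vc' ∧ Set.range vc' = Set.range vc ∧
    Canonical G g vc' S ∧ ConfigA G g vc' S

/-- `G` contains configuration ℬ with respect to `S`. -/
def ContainsB (G : SimpleGraph V) [DecidableRel G.Adj] (g : ℕ) (vc : ZMod g → V)
    (S : Set V) : Prop :=
  ∃ vc' : ZMod g → V, IsCycleLabelling G g vc' ∧ Set.range vc' = Set.range vc ∧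
    Canonical G g vc' S ∧ ConfigB G g vc' S

/-- `G` contains configuration 𝒞 with respect to `S`. -/
def ContainsC (G : SimpleGraph V) [DecidableRel G.Adj] (g : ℕ) (vc : ZMod g → V)
    (S : Set V) : Prop :=
  ∃ vc' : ZMod g → V, IsCycleLabelling G g vc' ∧ Set.range vc' = Set.range vc ∧
    Canonical G g vc' S ∧ ConfigC G g vc' S

/-- `G` contains configuration 𝒟 with respect to `S`. -/
def ContainsD (G : SimpleGraph V) [DecidableRel G.Adj] (g : ℕ) (vc : ZMod g → V)
    (S : Set V) : Prop :=
  ∃ vc' : ZMod g → V, IsCycleLabelling G g vc' ∧ Set.range vc' = Set.range vc ∧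
    Canonical G g vc' S ∧ ConfigD G g vc' S

/-- `G` contains configuration ℰ with respect to `S`. -/
def ContainsE (G : SimpleGraph V) [DecidableRel G.Adj] (g : ℕ) (vc : ZMod g → V)
    (S : Set V) : Prop :=
  ∃ vc' : ZMod g → V, IsCycleLabelling G g vc' ∧ Set.range vc' = Set.range vc ∧
    Canonical G g vc' S ∧ ConfigE G g vc' S

/-- `G` contains one of the configurations 𝒜, ℬ, 𝒞 with respect to `S`. -/
def ContainsABC (G : SimpleGraph V) [DecidableRel G.Adj] (g : ℕ) (vc : ZMod g → V)
    (S : Set V) : Prop :=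
  ContainsA G g vc S ∨ ContainsB G g vc S ∨ ContainsC G g vc S

/-- `G` contains one of the configurations 𝒜, 𝒟, ℰ with respect to `S`. -/
def ContainsADE (G : SimpleGraph V) [DecidableRel G.Adj] (g : ℕ) (vc : ZMod g → V)
    (S : Set V) : Prop :=
  ContainsA G g vc S ∨ ContainsD G g vc S ∨ ContainsE G g vc S

/-- `S` is a smallest branch-resolving set of `G`. -/
def SmallestBR (G : SimpleGraph V) [DecidableRel G.Adj] (S : Finset V) : Prop :=
  BranchResolving G ↑S ∧ ∀ S' : Finset V, BranchResolving G ↑S' → S.card ≤ S'.card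

/-- `S` is a smallest biactive branch-resolving set of `G`. -/
def SmallestBBR (G : SimpleGraph V) [DecidableRel G.Adj] (g : ℕ) (vc : ZMod g → V)
    (S : Finset V) : Prop :=
  BranchResolving G ↑S ∧ Biactive G g vc ↑S ∧
    ∀ S' : Finset V, BranchResolving G ↑S' → Biactive G g vc ↑S' → S.card ≤ S'.card

/-- `G` is 𝒜ℬ𝒞-negative. -/
def ABCneg (G : SimpleGraph V) [DecidableRel G.Adj] (g : ℕ) (vc : ZMod g → V) : Prop :=
  ∃ S : Finset V, SmallestBBR G g vc S ∧ ¬ ContainsABC G g vc ↑S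

/-- `G` is 𝒜𝒟ℰ-negative. -/
def ADEneg (G : SimpleGraph V) [DecidableRel G.Adj] (g : ℕ) (vc : ZMod g → V) : Prop :=
  ∃ S : Finset V, SmallestBBR G g vc S ∧ ¬ ContainsADE G g vc ↑S

end Defs

/-- If every edge leaving `A` ends at `v`, a walk from `A ∪ {v}` to the complement of `A`
visits `v`. -/
lemma SimpleGraph.Walk.mem_support_of_boundary {V : Type*} {G : SimpleGraph V} {A : Set V}
    {v : V} (hA : ∀ a ∈ A, ∀ b, G.Adj a b → b ∈ A ∨ b = v) {x y : V} (p : G.Walk x y)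
    (hx : x ∈ A ∨ x = v) (hy : y ∉ A) : v ∈ p.support := by
  induction p with
  | nil =>
    rcases hx with hx | rfl
    · exact absurd hx hy
    · simp
  | cons h q ih =>
    rcases hx with hx | rfl
    · simpa using Or.inr (ih (hA _ hx _ h) hy)
    · simp

/-- If every edge leaving `A` ends at `v`, then geodesics leaving `A ∪ {v}` pass through `v`. -/
lemma SimpleGraph.Connected.dist_eq_add_of_boundary {V : Type*} {G : SimpleGraph V}
    (hG : G.Connected) {A : Set V} {v : V} (hA : ∀ a ∈ A, ∀ b, G.Adj a b → b ∈ A ∨ b = v)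
    {x y : V} (hx : x ∈ A ∨ x = v) (hy : y ∉ A) :
    G.dist x y = G.dist x v + G.dist v y := by
  classical
  refine le_antisymm hG.dist_triangle ?_
  obtain ⟨p, hp⟩ := hG.exists_walk_length_eq_dist x y
  have hv := p.mem_support_of_boundary hA hx hy
  rw [← hp, ← p.take_spec hv, Walk.length_append]
  exact Nat.add_le_add (dist_le _) (dist_le _)

section Threads

variable {V : Type*} [Fintype V] {G : SimpleGraph V} [DecidableRel G.Adj]

lemma SimpleGraph.eq_of_adj_of_degree_eq_one {u a b : V} (h : G.degree u = 1)
    (ha : G.Adj u a) (hb : G.Adj u b) : a = b := by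
  have := Finset.card_le_one.1 h.le
  exact this a (by simpa using ha) b (by simpa using hb)

lemma SimpleGraph.eq_or_eq_of_adj_of_degree_eq_two {u a b c : V} (h : G.degree u = 2)
    (ha : G.Adj u a) (hb : G.Adj u b) (hab : a ≠ b) (hc : G.Adj u c) : c = a ∨ c = b := by
  classical
  have hsub : ({a, b} : Finset V) ⊆ G.neighborFinset u := by
    intro x hx
    rcases Finset.mem_insert.1 hx with rfl | hx
    · simpa using ha
    · rw [Finset.mem_singleton.1 hx]; simpa using hb
  have heq := Finset.eq_of_subset_of_card_le hsub (by rw [Finset.card_pair hab]; exact h.le)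
  have : c ∈ ({a, b} : Finset V) := by rw [heq]; simpa using hc
  simpa using this

/-- All neighbours of a pendant path `t` attached at `p` lie in `t` or are equal to `p`. -/
lemma mem_cons_of_adj_thread (t : List V) : ∀ p : V, (p :: t).Nodup →
    List.IsChain G.Adj (p :: t) → (∀ u ∈ t.getLast?, G.degree u = 1) →
    (∀ u ∈ t.dropLast, G.degree u = 2) → ∀ u ∈ t, ∀ w, G.Adj u w → w ∈ p :: t := by
  induction t with
  | nil => simp
  | cons u t ih =>
    intro p hnd hc h1 h2 x hx w hw
    rw [List.isChain_cons_cons] at hc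
    cases t with
    | nil =>
      obtain rfl : x = u := by simpa using hx
      rw [SimpleGraph.eq_of_adj_of_degree_eq_one (h1 x (by simp)) hw hc.1.symm]
      simp
    | cons u' r =>
      rcases List.mem_cons.1 hx with rfl | hx
      · have hne : p ≠ u' := by rintro rfl; simp at hnd
        rcases SimpleGraph.eq_or_eq_of_adj_of_degree_eq_two (h2 x (by simp)) hc.1.symm
          (List.isChain_cons_cons.1 hc.2).1 hne hw with rfl | rfl <;> simp
      · exact List.mem_cons_of_mem _ (ih u hnd.of_cons hc.2 (by simpa using h1)
          (fun y hy => h2 y (by simp [hy])) x hx w hw)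

/-- A pendant path attached at `p` is determined by its first vertex. -/
lemma thread_eq_of_head_eq (t : List V) : ∀ (p u : V) (r : List V), (p :: u :: t).Nodup →
    List.IsChain G.Adj (p :: u :: t) → (∀ x ∈ (u :: t).getLast?, G.degree x = 1) →
    (∀ x ∈ (u :: t).dropLast, G.degree x = 2) → (p :: u :: r).Nodup →
    List.IsChain G.Adj (p :: u :: r) → (∀ x ∈ (u :: r).getLast?, G.degree x = 1) →
    (∀ x ∈ (u :: r).dropLast, G.degree x = 2) → t = r := by
  induction t with
  | nil =>
    intro p u r _ _ h1 _ _ _ _ h2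
    cases r with
    | nil => rfl
    | cons b r =>
      have := h1 u (by simp)
      have := h2 u (by simp)
      omega
  | cons a t ih =>
    intro p u r hn hc h1 h2 hn' hc' h1' h2'
    have hu := h2 u (by simp)
    cases r with
    | nil =>
      have := h1' u (by simp)
      omega
    | cons b r =>
      have hpa : p ≠ a := by rintro rfl; simp at hn
      have hpb : p ≠ b := by rintro rfl; simp at hn'
      rw [List.isChain_cons_cons] at hc hc'
      obtain rfl : b = a := by
        rcases SimpleGraph.eq_or_eq_of_adj_of_degree_eq_two hu hc.1.symm
          (List.isChain_cons_cons.1 hc.2).1 hpa (List.isChain_cons_cons.1 hc'.2).1 with h | h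
        · exact absurd h.symm hpb
        · exact h
      rw [ih u b r hn.of_cons hc.2 (by simpa using h1) (fun y hy => h2 y (by simp [hy]))
        hn'.of_cons hc'.2 (by simpa using h1') (fun y hy => h2' y (by simp [hy]))]

lemma IsThreadAt.exists_cons {v : V} {t : List V} (ht : IsThreadAt G v t) :
    ∃ u r, t = u :: r ∧ (v :: u :: r).Nodup ∧ List.IsChain G.Adj (v :: u :: r) ∧
      (∀ x ∈ (u :: r).getLast?, G.degree x = 1) ∧
      (∀ x ∈ (u :: r).dropLast, G.degree x = 2) := by
  obtain ⟨hne, hnd, hv, -, hc, hh, h1, h2⟩ := ht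
  cases t with
  | nil => exact absurd rfl hne
  | cons u r =>
    exact ⟨u, r, rfl, List.nodup_cons.2 ⟨hv, hnd⟩,
      List.isChain_cons_cons.2 ⟨hh u (by simp), hc⟩, h1, h2⟩

lemma dist_head_of_thread (hG : G.Connected) {v u : V} {r : List V}
    (hn : (v :: u :: r).Nodup) (hc : List.IsChain G.Adj (v :: u :: r))
    (h1 : ∀ x ∈ (u :: r).getLast?, G.degree x = 1)
    (h2 : ∀ x ∈ (u :: r).dropLast, G.degree x = 2) {s : V} (hs : s ∉ u :: r) :
    G.dist s u = G.dist s v + 1 := by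
  have h := hG.dist_eq_add_of_boundary (A := {x | x ∈ u :: r}) (v := v) (x := u) (y := s)
    (fun a ha b hab => (List.mem_cons.1 (mem_cons_of_adj_thread _ v hn hc h1 h2 a ha b hab)).symm)
    (Or.inl (by simp)) hs
  have hvu : G.dist u v = 1 := dist_eq_one_iff_adj.2 (List.isChain_cons_cons.1 hc).1.symm
  rw [dist_comm, h, hvu, dist_comm, add_comm]

end Threads

/-- A metric generator of either kind separates any two neighbours `a ≠ b` of `v`
in terms of their distances relative to `v`. -/
lemma exists_dist_ne_of_metric_generator {V : Type*} {G : SimpleGraph V} {S : Set V}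
    (hS : IsVertexMG G S ∨ IsEdgeMG G S) {v a b : V} (ha : G.Adj v a) (hb : G.Adj v b)
    (hab : a ≠ b) : ∃ s ∈ S, ¬ (G.dist s a = G.dist s v + 1 ∧ G.dist s b = G.dist s v + 1) := by
  rcases hS with hS | hS
  · obtain ⟨s, hs, h⟩ := hS a b hab
    exact ⟨s, hs, fun h' => h (h'.1.trans h'.2.symm)⟩
  · obtain ⟨s, hs, h⟩ := hS s(v, a) ha s(v, b) hb (fun h => hab (Sym2.congr_right.1 h))
    refine ⟨s, hs, fun h' => h ?_⟩
    change min (G.dist s v) (G.dist s a) = min (G.dist s v) (G.dist s b)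
    rw [h'.1, h'.2]

lemma branchResolving_of_metric_generator {V : Type*} [Fintype V]
    {G : SimpleGraph V} [DecidableRel G.Adj] (hG : G.Connected) {S : Set V}
    (hS : IsVertexMG G S ∨ IsEdgeMG G S) : BranchResolving G S := by
  intro v t₁ t₂ ht₁ ht₂ hne
  obtain ⟨a, r, rfl, hn, hc, h1, h2⟩ := ht₁.exists_cons
  obtain ⟨b, r', rfl, hn', hc', h1', h2'⟩ := ht₂.exists_cons
  have hab : a ≠ b := by
    rintro rfl
    exact hne (by rw [thread_eq_of_head_eq r v a r' hn hc h1 h2 hn' hc' h1' h2'])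
  obtain ⟨s, hs, h⟩ := exists_dist_ne_of_metric_generator hS
    (List.isChain_cons_cons.1 hc).1 (List.isChain_cons_cons.1 hc').1 hab
  by_contra! hcon
  exact h ⟨dist_head_of_thread hG hn hc h1 h2 (hcon.1 s hs),
    dist_head_of_thread hG hn' hc' h1' h2' (hcon.2 s hs)⟩

section Cycle

variable {V : Type*} {G : SimpleGraph V} {g : ℕ} {vc : ZMod g → V}

lemma IsCycleLabelling.adj_fromEdgeSet (hvc : IsCycleLabelling G g vc) (i : ZMod g) :
    (fromEdgeSet (cycleEdges g vc)).Adj (vc i) (vc (i + 1)) :=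
  (fromEdgeSet_adj _).2 ⟨⟨i, rfl⟩, (hvc.2 i).ne⟩

lemma IsCycleLabelling.fromEdgeSet_le (hvc : IsCycleLabelling G g vc) :
    fromEdgeSet (cycleEdges g vc) ≤ G := by
  intro x y h
  obtain ⟨⟨i, hi⟩, -⟩ := (fromEdgeSet_adj _).1 h
  have := hvc.2 i
  rwa [← mem_edgeSet, ← hi, mem_edgeSet] at this

lemma IsCycleLabelling.fromEdgeSet_reachable [NeZero g] (hvc : IsCycleLabelling G g vc)
    (i j : ZMod g) : (fromEdgeSet (cycleEdges g vc)).Reachable (vc i) (vc j) := by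
  have h0 (n : ℕ) : (fromEdgeSet (cycleEdges g vc)).Reachable (vc 0) (vc n) := by
    induction n with
    | zero => simp
    | succ n ih => simpa using ih.trans (hvc.adj_fromEdgeSet n).reachable
  have h (k : ZMod g) := h0 k.val
  simp only [ZMod.natCast_val, ZMod.cast_id', id] at h
  exact (h i).symm.trans (h j)

lemma IsCycleLabelling.exists_isCycle (hg : 3 ≤ g) (hvc : IsCycleLabelling G g vc) :
    ∃ (u : V) (w : G.Walk u u), w.IsCycle ∧ ∀ e ∈ w.edges, e ∈ cycleEdges g vc := by
  set H := fromEdgeSet (cycleEdges g vc)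
  have hne (n : ℕ) (h1 : 1 ≤ n) (hn : n < g) :
      s(vc (n : ZMod g), vc ((n : ZMod g) + 1)) ≠ s(vc 0, vc (0 + 1)) := by
    intro h
    rcases Sym2.eq_iff.1 h with ⟨h, -⟩ | ⟨h, h'⟩
    · have := hvc.1 h
      rw [ZMod.natCast_eq_zero_iff] at this
      exact absurd (Nat.le_of_dvd h1 this) (by omega)
    · have e1 := hvc.1 h
      have e2 := hvc.1 h'
      rw [e1] at e2
      have : ((2 : ℕ) : ZMod g) = 0 := by push_cast; linear_combination e2
      rw [ZMod.natCast_eq_zero_iff] at this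
      exact absurd (Nat.le_of_dvd (by omega) this) (by omega)
  have hreach (n : ℕ) (hn : n + 1 ≤ g) :
      (H \ fromEdgeSet {s(vc 0, vc (0 + 1))}).Reachable (vc (0 + 1)) (vc ((n + 1 : ℕ))) := by
    induction n with
    | zero => simp
    | succ n ih =>
      refine (ih (by omega)).trans (Adj.reachable ?_)
      rw [sdiff_adj]
      push_cast
      have h := hvc.adj_fromEdgeSet ((n : ZMod g) + 1)
      refine ⟨h, fun h' => ?_⟩
      have := hne (n + 1) (by omega) (by omega)
      push_cast at this
      exact this ((fromEdgeSet_adj _).1 h').1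
  have h := hreach (g - 1) (by omega)
  rw [Nat.sub_add_cancel (by omega), ZMod.natCast_self] at h
  obtain ⟨u, p, hp, -⟩ := adj_and_reachable_delete_edges_iff_exists_cycle.1
    ⟨hvc.adj_fromEdgeSet 0, h.symm⟩
  refine ⟨u, p.mapLe hvc.fromEdgeSet_le, hp.mapLe _, fun e he => ?_⟩
  rw [Walk.edges_mapLe_eq_edges] at he
  have := p.edges_subset_edgeSet he
  rw [edgeSet_fromEdgeSet] at this
  exact this.1

/-- Distinct cycle vertices of a unicyclic graph lie in different components off the cycle. -/
lemma IsUnicyclic.eq_of_inTree (hG : IsUnicyclic G) (hg : 3 ≤ g)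
    (hvc : IsCycleLabelling G g vc) {i j : ZMod g} (h : inTree G g vc i (vc j)) : i = j := by
  classical
  have : NeZero g := ⟨by omega⟩
  by_contra hij
  obtain ⟨p, hp⟩ := h.exists_isPath
  have hvij : vc i ≠ vc j := fun h => hij (hvc.1 h)
  generalize hx : vc i = x at p
  cases p with
  | nil => exact hvij hx
  | @cons _ y _ hadj q =>
    subst hx
    rw [Walk.cons_isPath_iff] at hp
    have hoff := deleteEdges_adj.1 hadj
    have h1 : (G \ fromEdgeSet {s(vc i, y)}).Reachable y (vc j) := by
      refine ⟨q.transfer _ fun e he => ?_⟩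
      have heG : e ∈ (offCycle G g vc).edgeSet := q.edges_subset_edgeSet he
      have hee : e ≠ s(vc i, y) := by
        rintro rfl
        exact hp.2 (q.fst_mem_support_of_mem_edges he)
      rw [edgeSet_sdiff, edgeSet_fromEdgeSet]
      refine ⟨?_, fun h' => hee h'.1⟩
      exact edgeSet_mono (deleteEdges_le _) heG
    have h2 : (G \ fromEdgeSet {s(vc i, y)}).Reachable (vc j) (vc i) := by
      refine (hvc.fromEdgeSet_reachable j i).mono fun a b hab => ?_
      rw [sdiff_adj]
      refine ⟨hvc.fromEdgeSet_le hab, fun h' => hoff.2 ?_⟩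
      have e1 := ((fromEdgeSet_adj _).1 h').1
      rw [Set.mem_singleton_iff] at e1
      rw [← e1]
      exact ((fromEdgeSet_adj _).1 hab).1
    obtain ⟨u, w, hw, hmem⟩ := adj_and_reachable_delete_edges_iff_exists_cycle.1
      ⟨hoff.1, (h1.trans h2).symm⟩
    obtain ⟨u', w', hw', hsub⟩ := hvc.exists_isCycle hg
    exact hoff.2 (hsub _ ((hG.2.2 u u' w w' hw hw' _).1 hmem))

lemma exists_inTree (hG : G.Connected) (x : V) : ∃ i, inTree G g vc i x := by
  obtain ⟨p⟩ := hG.preconnected x (vc 0)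
  generalize hy : vc 0 = y at p
  induction p with
  | nil => exact ⟨0, hy ▸ Reachable.refl _⟩
  | @cons a b _ h q ih =>
    obtain ⟨i, hi⟩ := ih hy
    by_cases hab : s(a, b) ∈ cycleEdges g vc
    · obtain ⟨k, hk⟩ := hab
      rcases Sym2.eq_iff.1 hk with ⟨rfl, -⟩ | ⟨rfl, -⟩
      · exact ⟨k, Reachable.refl _⟩
      · exact ⟨k + 1, Reachable.refl _⟩
    · exact ⟨i, Reachable.trans hi (Adj.reachable (deleteEdges_adj.2 ⟨h, hab⟩)).symm⟩

lemma dist_of_inTree (hG : IsUnicyclic G) (hg : 3 ≤ g) (hvc : IsCycleLabelling G g vc)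
    {i j : ZMod g} (hij : G.Adj (vc i) (vc j)) {s : V} (hs : inTree G g vc i s) :
    G.dist s (vc j) = G.dist s (vc i) + 1 := by
  have hji : ¬ inTree G g vc i (vc j) := fun h => hij.ne (by rw [hG.eq_of_inTree hg hvc h])
  rw [hG.1.dist_eq_add_of_boundary (A := {x | inTree G g vc i x ∧ x ≠ vc i}) (v := vc i)
    ?_ ?_ (fun h => hji h.1), dist_eq_one_iff_adj.2 hij]
  · rintro a ⟨ha, hne⟩ b hab
    refine or_iff_not_imp_right.2 fun hb => ⟨?_, hb⟩
    refine Reachable.trans ha (Adj.reachable (deleteEdges_adj.2 ⟨hab, ?_⟩))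
    rintro ⟨k, hk⟩
    rcases Sym2.eq_iff.1 hk with ⟨rfl, -⟩ | ⟨rfl, -⟩
    · exact hne (by rw [hG.eq_of_inTree hg hvc ha])
    · exact hne (by rw [hG.eq_of_inTree hg hvc ha])
  · by_cases h : s = vc i
    · exact Or.inr h
    · exact Or.inl ⟨hs, h⟩

lemma two_le_aS_of_metric_generator (hG : IsUnicyclic G) (hg : 3 ≤ g)
    (hvc : IsCycleLabelling G g vc) {S : Set V} (hS : IsVertexMG G S ∨ IsEdgeMG G S) :
    2 ≤ aS G g vc S := by
  have : NeZero g := ⟨by omega⟩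
  by_contra hlt
  have hone : ∀ i j, SActive G g vc S i → SActive G g vc S j → i = j := fun i j hi hj =>
    (Set.ncard_le_one (Set.toFinite _)).1 (Nat.le_of_lt_succ (not_le.1 hlt)) i hi j hj
  obtain ⟨i, hi⟩ : ∃ i, ∀ s ∈ S, inTree G g vc i s := by
    rcases S.eq_empty_or_nonempty with rfl | ⟨s₀, hs₀⟩
    · exact ⟨0, by simp⟩
    · obtain ⟨i, hi⟩ := exists_inTree (g := g) (vc := vc) hG.1 s₀
      refine ⟨i, fun s hs => ?_⟩
      obtain ⟨j, hj⟩ := exists_inTree (g := g) (vc := vc) hG.1 s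
      rwa [hone i j ⟨s₀, hs₀, hi⟩ ⟨s, hs, hj⟩]
  have hr := hvc.2 i
  have hl : G.Adj (vc i) (vc (i - 1)) := by simpa using (hvc.2 (i - 1)).symm
  have hne : vc (i + 1) ≠ vc (i - 1) := by
    intro h
    have h' := hvc.1 h
    have : ((2 : ℕ) : ZMod g) = 0 := by push_cast; linear_combination h'
    rw [ZMod.natCast_eq_zero_iff] at this
    exact absurd (Nat.le_of_dvd (by omega) this) (by omega)
  obtain ⟨s, hs, h⟩ := exists_dist_ne_of_metric_generator hS hr hl hne
  exact h ⟨dist_of_inTree hG hg hvc hr (hi s hs), dist_of_inTree hG hg hvc hl (hi s hs)⟩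

end Cycle

theorem statement_0 {V : Type*} [Fintype V] [DecidableEq V] (G : SimpleGraph V)
    [DecidableRel G.Adj] (hG : IsUnicyclic G) (g : ℕ) (hg : 3 ≤ g)
    (vc : ZMod g → V) (hvc : IsCycleLabelling G g vc)
    (S : Set V) (hS : IsVertexMG G S ∨ IsEdgeMG G S) :
    BranchResolving G S ∧ 2 ≤ aS G g vc S :=
  ⟨branchResolving_of_metric_generator hG.1 hS, two_le_aS_of_metric_generator hG hg hvc hS⟩
end

section
/- Let G be a unicyclic graph with cycle C, and let S ⊆ V(G) be a branch-resolving set with a_S(C) ≥ 3 such that three S-active vertices on C form a geodesic triple. Then S is both a vertex metric generator and an edge metric generator of G. -/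
open SimpleGraph

/-- The distance of the positions `a, b < n` on a cycle of length `n`. -/
def cyc (n a b : ℕ) : ℕ := min (max a b - min a b) (n - (max a b - min a b))

theorem cyc_comm (n a b : ℕ) : cyc n a b = cyc n b a := by
  unfold cyc; rw [max_comm, min_comm a b]

theorem cyc_triangle {n a b Q : ℕ} (ha : a < n) (hb : b < n) (hQ : Q < n) :
    cyc n a b ≤ cyc n a Q + cyc n b Q := by
  unfold cyc; omega

theorem cyc_arc {n a b c P : ℕ} (hab : a < b) (hbc : b < c) (hc : c < n) (hP : P < n)
    (ht : cyc n a b + cyc n b c + cyc n a c = n) :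
    cyc n a P + cyc n b P = cyc n a b ∨ cyc n b P + cyc n c P = cyc n b c ∨
      cyc n a P + cyc n c P = cyc n a c := by
  have h1 : 2 * (b - a) ≤ n ∧ 2 * (c - b) ≤ n ∧ n ≤ 2 * (c - a) := by unfold cyc at ht; omega
  clear ht
  rcases Nat.lt_or_ge P a with p | p
  · right; right; unfold cyc; omega
  rcases Nat.lt_or_ge P b with p | p
  · left; unfold cyc; omega
  rcases Nat.lt_or_ge P c with p | p
  · right; left; unfold cyc; omega
  · right; right; unfold cyc; omega

theorem cyc_eq_cyc {n a P Q : ℕ} (ha : a < n) (hP : P < n) (hQ : Q < n)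
    (h : cyc n a P = cyc n a Q) :
    P = Q ∨ P + Q + n = 2 * a ∨ P + Q = 2 * a ∨ P + Q = 2 * a + n := by
  unfold cyc at h; omega

theorem eq_of_cyc_add_eq_of_lt {n a b c P Q h k : ℕ} (hab : a < b) (hbc : b < c) (hc : c < n)
    (hP : P < n) (hQ : Q < n) (ht : cyc n a b + cyc n b c + cyc n a c = n)
    (ea : cyc n a P + h = cyc n a Q + k) (eb : cyc n b P + h = cyc n b Q + k)
    (ec : cyc n c P + h = cyc n c Q + k) : P = Q := by
  have hb : b < n := by omega
  have ha : a < n := by omega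
  have hk : h = k := by
    have := cyc_arc hab hbc hc hP ht
    have := cyc_arc hab hbc hc hQ ht
    have := cyc_triangle ha hb hP
    have := cyc_triangle ha hb hQ
    have := cyc_triangle ha hc hP
    have := cyc_triangle ha hc hQ
    have := cyc_triangle hb hc hP
    have := cyc_triangle hb hc hQ
    omega
  have := cyc_eq_cyc ha hP hQ (by omega)
  have := cyc_eq_cyc hb hP hQ (by omega)
  have := cyc_eq_cyc hc hP hQ (by omega)
  omega

/-- A geodesic triple of a cycle distinguishes any two pendant positions with distinct feet. -/
theorem eq_of_cyc_add_eq {n a b c P Q h k : ℕ} (hab : a ≠ b) (hbc : b ≠ c) (hac : a ≠ c)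
    (ha : a < n) (hb : b < n) (hc : c < n) (hP : P < n) (hQ : Q < n)
    (ht : cyc n a b + cyc n b c + cyc n a c = n)
    (ea : cyc n a P + h = cyc n a Q + k) (eb : cyc n b P + h = cyc n b Q + k)
    (ec : cyc n c P + h = cyc n c Q + k) : P = Q := by
  have h1 := cyc_comm n a b
  have h2 := cyc_comm n b c
  have h3 := cyc_comm n a c
  rcases lt_or_gt_of_ne hab with x | x <;> rcases lt_or_gt_of_ne hbc with y | y <;>
    rcases lt_or_gt_of_ne hac with z | z
  · exact eq_of_cyc_add_eq_of_lt x y hc hP hQ (by omega) ea eb ec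
  · omega
  · exact eq_of_cyc_add_eq_of_lt z y hb hP hQ (by omega) ea ec eb
  · exact eq_of_cyc_add_eq_of_lt z x hb hP hQ (by omega) ec ea eb
  · exact eq_of_cyc_add_eq_of_lt x z hc hP hQ (by omega) eb ea ec
  · exact eq_of_cyc_add_eq_of_lt y z ha hP hQ (by omega) eb ec ea
  · omega
  · exact eq_of_cyc_add_eq_of_lt y x ha hP hQ (by omega) ec eb ea

section BridgeMetric

variable {V : Type*} {G : SimpleGraph V}

theorem dist_add_dist_of_mem_support {s y m : V} (p : G.Walk s y)
    (hp : p.length = G.dist s y) (hm : m ∈ p.support) (hc : G.Connected) :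
    G.dist s y = G.dist s m + G.dist m y := by
  classical
  have h1 := congrArg Walk.length (p.take_spec hm)
  rw [Walk.length_append] at h1
  have h2 := dist_le (p.takeUntil m hm)
  have h3 := dist_le (p.dropUntil m hm)
  have h4 : G.dist s y ≤ G.dist s m + G.dist m y := hc.dist_triangle
  omega

/-- The metric content of `xw` being a bridge of a connected graph. -/
structure MetricBridge (G : SimpleGraph V) (x w : V) : Prop where
  adj : G.Adj x w
  side : ∀ s, G.dist s w = G.dist s x + 1 ∨ G.dist s x = G.dist s w + 1
  sep : ∀ s y, G.dist s w = G.dist s x + 1 → G.dist y x = G.dist y w + 1 →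
    G.dist s y = G.dist s x + 1 + G.dist y w

theorem MetricBridge.symm {x w : V} (h : MetricBridge G x w) : MetricBridge G w x where
  adj := h.adj.symm
  side s := (h.side s).symm
  sep s y hs hy := by
    have := h.sep y s hy hs
    rw [dist_comm] at this
    omega

theorem reachable_deleteEdges_or (hc : G.Connected) (x w s : V) :
    (G.deleteEdges {s(x, w)}).Reachable s x ∨ (G.deleteEdges {s(x, w)}).Reachable s w := by
  obtain ⟨p⟩ := hc.preconnected s x
  induction p with
  | nil => exact Or.inl .rfl
  | @cons a b c hab p ih =>
    by_cases he : s(a, b) = s(c, w)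
    · rcases Sym2.eq_iff.1 he with ⟨rfl, -⟩ | ⟨rfl, -⟩
      · exact Or.inl .rfl
      · exact Or.inr .rfl
    · have h : (G.deleteEdges {s(c, w)}).Adj a b := by
        rw [deleteEdges_adj]; exact ⟨hab, he⟩
      exact ih.imp h.reachable.trans h.reachable.trans

theorem dist_eq_of_isBridge (hc : G.Connected) {x w s y : V} (hadj : G.Adj x w)
    (hb : G.IsBridge s(x, w)) (hs : (G.deleteEdges {s(x, w)}).Reachable s x)
    (hy : (G.deleteEdges {s(x, w)}).Reachable y w) :
    G.dist s y = G.dist s x + 1 + G.dist y w := by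
  have key : ∀ a b, (G.deleteEdges {s(x, w)}).Reachable a x →
      (G.deleteEdges {s(x, w)}).Reachable b w → ∀ p : G.Walk a b,
      x ∈ p.support ∧ w ∈ p.support := by
    intro a b ha hb' p
    have he : s(x, w) ∈ p.edges := by
      by_contra he
      exact isBridge_iff.1 hb
        ((ha.symm.trans ⟨p.toDeleteEdge _ he⟩).trans hb')
    exact ⟨p.fst_mem_support_of_mem_edges he, p.snd_mem_support_of_mem_edges he⟩
  obtain ⟨p, hp⟩ := hc.exists_walk_length_eq_dist s y
  obtain ⟨q, hq⟩ := hc.exists_walk_length_eq_dist x y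
  have h1 := dist_add_dist_of_mem_support p hp (key _ _ hs hy p).1 hc
  have h2 := dist_add_dist_of_mem_support q hq (key _ _ .rfl hy q).2 hc
  rw [dist_eq_one_iff_adj.2 hadj, dist_comm (u := w)] at h2
  omega

theorem MetricBridge.of_isBridge (hc : G.Connected) {x w : V} (hadj : G.Adj x w)
    (hb : G.IsBridge s(x, w)) : MetricBridge G x w := by
  have hl : ∀ s, (G.deleteEdges {s(x, w)}).Reachable s x → G.dist s w = G.dist s x + 1 := by
    intro s hs
    simpa using dist_eq_of_isBridge hc hadj hb hs .rfl
  have hr : ∀ s, (G.deleteEdges {s(x, w)}).Reachable s w → G.dist s x = G.dist s w + 1 := by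
    intro s hs
    have := dist_eq_of_isBridge hc hadj hb .rfl hs
    rw [dist_comm, dist_self] at this
    omega
  refine ⟨hadj, fun s => (reachable_deleteEdges_or hc x w s).imp (hl s) (hr s), ?_⟩
  intro s y hs hy
  refine dist_eq_of_isBridge hc hadj hb ?_ ?_
  · refine (reachable_deleteEdges_or hc x w s).resolve_right fun h => ?_
    have := hr s h
    omega
  · refine (reachable_deleteEdges_or hc x w y).resolve_left fun h => ?_
    have := hl y h
    omega

/-- Only the edge `xw` itself leads from the side of `x` to the side of `w`. -/
theorem MetricBridge.side_of_adj {x w y y' : V} (h : MetricBridge G x w) (hc : G.Connected)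
    (hadj : G.Adj y y') (hne : ¬ (y = x ∧ y' = w)) (hy : G.dist y w = G.dist y x + 1) :
    G.dist y' w = G.dist y' x + 1 := by
  refine (h.side y').resolve_right fun hy' => hne ?_
  have h1 := h.sep y y' hy hy'
  rw [dist_eq_one_iff_adj.2 hadj] at h1
  exact ⟨hc.dist_eq_zero_iff.1 (by omega), hc.dist_eq_zero_iff.1 (by omega)⟩

end BridgeMetric

section BridgedCycle

variable {V : Type*} {G : SimpleGraph V} {g : ℕ} {vc : ZMod g → V}

/-- A connected graph with a labelled cycle all of whose other edges are bridges. -/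
structure BridgedCycle (G : SimpleGraph V) (g : ℕ) (vc : ZMod g → V) : Prop where
  conn : G.Connected
  three_le : 3 ≤ g
  lab : IsCycleLabelling G g vc
  bridge : ∀ x w, (offCycle G g vc).Adj x w → MetricBridge G x w

theorem offCycle_adj {x w : V} :
    (offCycle G g vc).Adj x w ↔ G.Adj x w ∧ s(x, w) ∉ cycleEdges g vc :=
  deleteEdges_adj

namespace BridgedCycle

/-- All cycle vertices lie on the same side of an edge outside the cycle. -/
theorem same_side (h : BridgedCycle G g vc) {x w : V} (hxw : (offCycle G g vc).Adj x w)
    (i j : ZMod g) (hi : G.dist (vc i) w = G.dist (vc i) x + 1) :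
    G.dist (vc j) w = G.dist (vc j) x + 1 := by
  have hb := h.bridge x w hxw
  have : NeZero g := ⟨by have := h.three_le; omega⟩
  have step : ∀ n : ℕ, G.dist (vc (i + n)) w = G.dist (vc (i + n)) x + 1 := by
    intro n
    induction n with
    | zero => simpa using hi
    | succ n ih =>
      have e : i + ((n + 1 : ℕ) : ZMod g) = i + n + 1 := by push_cast; ring
      rw [e]
      refine hb.side_of_adj h.conn (h.lab.2 _) ?_ ih
      rintro ⟨rfl, rfl⟩
      exact (offCycle_adj.1 hxw).2 ⟨_, rfl⟩
  have := step (j - i).val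
  rwa [ZMod.natCast_zmod_val, add_sub_cancel] at this

theorem dist_of_inTree (h : BridgedCycle G g vc) {i : ZMod g} {s : V}
    (hs : inTree G g vc i s) (j : ZMod g) :
    G.dist s (vc j) = G.dist s (vc i) + G.dist (vc i) (vc j) := by
  have hs' := hs.symm
  obtain ⟨p⟩ := hs'
  clear hs
  generalize hv : vc i = r at p ⊢
  induction p with
  | nil => simp
  | @cons a b c hab p ih =>
    subst hv
    have ih := ih rfl
    have hb := h.bridge a b hab
    rw [dist_comm (u := a), dist_comm (u := a)]
    rw [dist_comm (u := b), dist_comm (u := b)] at ih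
    rcases hb.side (vc i) with h1 | h1
    · have := h.same_side hab i j h1
      omega
    · have := h.same_side hab.symm i j h1
      omega

theorem inTree_unique (h : BridgedCycle G g vc) {i j : ZMod g} {s : V}
    (hi : inTree G g vc i s) (hj : inTree G g vc j s) : i = j := by
  have h1 := h.dist_of_inTree hi j
  have h2 := h.dist_of_inTree hj i
  exact h.lab.1 (h.conn.dist_eq_zero_iff.1 (by omega))

theorem inTree_of_adj {i : ZMod g} {x w : V} (hx : inTree G g vc i x)
    (hxw : (offCycle G g vc).Adj x w) : inTree G g vc i w :=
  hx.trans hxw.reachable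

theorem inTree_self (i : ZMod g) : inTree G g vc i (vc i) := .rfl

theorem exists_inTree (h : BridgedCycle G g vc) (x : V) : ∃ i, inTree G g vc i x := by
  obtain ⟨p⟩ := h.conn.preconnected x (vc 0)
  generalize hv : vc 0 = r at p
  induction p with
  | nil => subst hv; exact ⟨0, inTree_self 0⟩
  | @cons a b c hab p ih =>
    obtain ⟨i, hi⟩ := ih hv
    by_cases he : s(a, b) ∈ cycleEdges g vc
    · obtain ⟨k, hk⟩ := he
      rcases Sym2.eq_iff.1 hk with ⟨rfl, -⟩ | ⟨rfl, -⟩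
      · exact ⟨_, inTree_self _⟩
      · exact ⟨_, inTree_self _⟩
    · exact ⟨i, inTree_of_adj hi (offCycle_adj.2 ⟨hab, he⟩).symm⟩

theorem dist_of_inTree_of_inTree (h : BridgedCycle G g vc) {i j : ZMod g} (hij : i ≠ j)
    {s y : V} (hs : inTree G g vc i s) (hy : inTree G g vc j y) :
    G.dist s y = G.dist s (vc i) + G.dist (vc i) y := by
  -- an edge of the tree at `v_i` does not separate the vertices of the tree at `v_j`
  have sameSide : ∀ x w, (offCycle G g vc).Adj x w → inTree G g vc i x →
      G.dist (vc i) w = G.dist (vc i) x + 1 → G.dist y w = G.dist y x + 1 := by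
    intro x w hxw hx hi
    have hy' := hy.symm
    obtain ⟨p⟩ := hy'
    generalize hv : vc j = r at p
    induction p with
    | nil => subst hv; exact h.same_side hxw i j hi
    | @cons a b c hab p ih =>
      have hbt := inTree_of_adj hy hab
      refine (h.bridge x w hxw).side_of_adj h.conn (offCycle_adj.1 hab).1.symm ?_ (ih hbt hv)
      rintro ⟨rfl, -⟩
      exact hij (h.inTree_unique hx hbt)
  have hs' := hs.symm
  obtain ⟨p⟩ := hs'
  generalize hv : vc i = r at p
  induction p with
  | nil => subst hv; simp
  | @cons a b c hab p ih =>
    subst hv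
    have hbt := inTree_of_adj hs hab
    have ih := ih hbt rfl
    rw [dist_comm (u := a), dist_comm (u := a)]
    rw [dist_comm (u := b), dist_comm (u := b)] at ih
    rcases (h.bridge a b hab).side (vc i) with h1 | h1
    · have := sameSide a b hab hs h1
      omega
    · have := sameSide b a hab.symm hbt h1
      omega

theorem val_add_one (hg : 3 ≤ g) (i : ZMod g) :
    (i + 1).val = i.val + 1 ∧ i.val + 1 < g ∨ (i + 1).val = 0 ∧ i.val + 1 = g := by
  have : NeZero g := ⟨by omega⟩
  have : Fact (1 < g) := ⟨by omega⟩
  have hi := ZMod.val_lt i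
  have h1 := ZMod.val_add i 1
  rw [ZMod.val_one] at h1
  rcases Nat.lt_or_ge (i.val + 1) g with h | h
  · left
    rw [Nat.mod_eq_of_lt h] at h1
    exact ⟨h1, h⟩
  · right
    have h2 : i.val + 1 = g := by omega
    rw [h2, Nat.mod_self] at h1
    exact ⟨h1, h2⟩

theorem dist_cycle_le (h : BridgedCycle G g vc) (i : ZMod g) (n : ℕ) :
    G.dist (vc i) (vc (i + n)) ≤ n := by
  induction n with
  | zero => simp
  | succ n ih =>
    have e : i + ((n + 1 : ℕ) : ZMod g) = i + n + 1 := by push_cast; ring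
    have h1 : G.dist (vc i) (vc (i + n + 1)) ≤ _ :=
      h.conn.dist_triangle (v := vc (i + n))
    rw [dist_eq_one_iff_adj.2 (h.lab.2 _)] at h1
    rw [e]
    omega

theorem cyc_le_of_walk (h : BridgedCycle G g vc) (i j : ZMod g) {x y : V} (p : G.Walk x y)
    {k : ZMod g} (hx : inTree G g vc j x) (hy : inTree G g vc k y) :
    cyc g i.val j.val ≤ p.length + cyc g i.val k.val := by
  have : NeZero g := ⟨by have := h.three_le; omega⟩
  induction p generalizing j with
  | nil => rw [h.inTree_unique hx hy]; simp
  | @cons a b c hab p ih =>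
    rw [Walk.length_cons]
    have hi := ZMod.val_lt i
    by_cases he : s(a, b) ∈ cycleEdges g vc
    · obtain ⟨l, hl⟩ := he
      have hstep : cyc g l.val (l + 1).val ≤ 1 := by
        have := val_add_one h.three_le l
        unfold cyc
        omega
      have hl1 := ZMod.val_lt l
      have hl2 := ZMod.val_lt (l + 1)
      rcases Sym2.eq_iff.1 hl with ⟨rfl, rfl⟩ | ⟨rfl, rfl⟩
      · have := ih _ (inTree_self _) hy
        have := cyc_triangle hi hl1 hl2
        rw [h.inTree_unique hx (inTree_self _)]
        omega
      · have := ih _ (inTree_self _) hy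
        have := cyc_triangle hi hl2 hl1
        rw [cyc_comm] at hstep
        rw [h.inTree_unique hx (inTree_self _)]
        omega
    · have := ih j (inTree_of_adj hx (offCycle_adj.2 ⟨hab, he⟩)) hy
      omega

theorem dist_cycle (h : BridgedCycle G g vc) (i j : ZMod g) :
    G.dist (vc i) (vc j) = cyc g i.val j.val := by
  have : NeZero g := ⟨by have := h.three_le; omega⟩
  refine le_antisymm ?_ ?_
  · have key : ∀ i j : ZMod g, i.val ≤ j.val →
        G.dist (vc i) (vc j) ≤ cyc g i.val j.val := by
      intro i j hij
      have hj := ZMod.val_lt j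
      have h1 := h.dist_cycle_le i (j.val - i.val)
      have h2 := h.dist_cycle_le j (g - (j.val - i.val))
      rw [Nat.cast_sub hij, ZMod.natCast_zmod_val, ZMod.natCast_zmod_val,
        add_sub_cancel] at h1
      rw [Nat.cast_sub (by omega), Nat.cast_sub hij, ZMod.natCast_zmod_val,
        ZMod.natCast_zmod_val, ZMod.natCast_self, zero_sub, neg_sub, add_sub_cancel,
        dist_comm] at h2
      unfold cyc
      omega
    rcases le_total i.val j.val with hij | hij
    · exact key i j hij
    · rw [dist_comm, cyc_comm]
      exact key j i hij
  · obtain ⟨p, hp⟩ := h.conn.exists_walk_length_eq_dist (vc j) (vc i)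
    have := h.cyc_le_of_walk i j p (inTree_self _) (inTree_self _)
    rw [hp, dist_comm] at this
    have e : cyc g i.val i.val = 0 := by simp [cyc]
    omega

end BridgedCycle

theorem exists_cycle_walk (hlab : IsCycleLabelling G g vc) (n : ℕ) :
    ∃ p : G.Walk (vc n) (vc 0), (∀ x ∈ p.support, ∃ m ≤ n, x = vc (m : ℕ)) ∧
      (∀ e ∈ p.edges, ∃ m < n, e = s(vc (m : ℕ), vc (m + 1 : ℕ))) ∧ (n < g → p.IsPath) := by
  induction n with
  | zero =>
    refine ⟨Walk.nil.copy (by simp) rfl, ?_, ?_, ?_⟩ <;> simp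
  | succ n ih =>
    obtain ⟨p, h1, h2, h3⟩ := ih
    have hadj : G.Adj (vc (n + 1 : ℕ)) (vc n) := by
      have := (hlab.2 n).symm
      rwa [← Nat.cast_succ] at this
    refine ⟨.cons hadj p, ?_, ?_, ?_⟩
    · intro x hx
      rw [Walk.support_cons, List.mem_cons] at hx
      rcases hx with rfl | hx
      · exact ⟨_, le_rfl, rfl⟩
      · obtain ⟨m, hm, rfl⟩ := h1 x hx
        exact ⟨m, by omega, rfl⟩
    · intro e he
      rw [Walk.edges_cons, List.mem_cons] at he
      rcases he with rfl | he
      · exact ⟨n, by omega, Sym2.eq_swap⟩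
      · obtain ⟨m, hm, rfl⟩ := h2 e he
        exact ⟨m, by omega, rfl⟩
    · intro hn
      rw [Walk.cons_isPath_iff]
      refine ⟨h3 (by omega), fun hmem => ?_⟩
      obtain ⟨m, hm, he⟩ := h1 _ hmem
      have := (ZMod.natCast_eq_natCast_iff' _ _ _).1 (hlab.1 he)
      rw [Nat.mod_eq_of_lt hn, Nat.mod_eq_of_lt (by omega)] at this
      omega

theorem exists_isCycle_of_labelling (hg : 3 ≤ g) (hlab : IsCycleLabelling G g vc) :
    ∃ (u : V) (p : G.Walk u u), p.IsCycle ∧ ∀ e ∈ p.edges, e ∈ cycleEdges g vc := by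
  obtain ⟨p, h1, h2, h3⟩ := exists_cycle_walk hlab (g - 1)
  have hcast : ((g - 1 : ℕ) : ZMod g) + 1 = 0 := by
    rw [← Nat.cast_succ, Nat.succ_eq_add_one, Nat.sub_add_cancel (by omega),
      ZMod.natCast_self]
  have hadj : G.Adj (vc 0) (vc (g - 1 : ℕ)) := by
    have := (hlab.2 (g - 1 : ℕ)).symm
    rwa [hcast] at this
  refine ⟨_, .cons hadj p, (Walk.cons_isCycle_iff _ _).2 ⟨h3 (by omega), ?_⟩, ?_⟩
  · intro hmem
    obtain ⟨m, hm, he⟩ := h2 _ hmem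
    have key : ∀ a b : ℕ, a < g → b < g → vc a = vc b → a = b := by
      intro a b ha hb hab
      have := (ZMod.natCast_eq_natCast_iff' _ _ _).1 (hlab.1 hab)
      rwa [Nat.mod_eq_of_lt ha, Nat.mod_eq_of_lt hb] at this
    rcases Sym2.eq_iff.1 he with ⟨e', e⟩ | ⟨-, e2⟩
    · have := key _ _ (by omega) (by omega) e
      have e0 := key 0 m (by omega) (by omega) (by rw [Nat.cast_zero, e'])
      omega
    · have := key _ _ (by omega) (by omega) e2
      omega
  · intro e he
    rw [Walk.edges_cons, List.mem_cons] at he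
    rcases he with rfl | he
    · exact ⟨(g - 1 : ℕ), by rw [hcast, Sym2.eq_swap]⟩
    · obtain ⟨m, -, rfl⟩ := h2 e he
      exact ⟨m, by push_cast; rfl⟩

theorem IsUnicyclic.bridgedCycle (hG : IsUnicyclic G) (hg : 3 ≤ g)
    (hlab : IsCycleLabelling G g vc) : BridgedCycle G g vc := by
  refine ⟨hG.1, hg, hlab, fun x w hxw => ?_⟩
  obtain ⟨hadj, hne⟩ := offCycle_adj.1 hxw
  refine .of_isBridge hG.1 hadj ?_
  rw [isBridge_iff_forall_cycle_notMem hadj]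
  intro u p hp he
  obtain ⟨u', q, hq, hqe⟩ := exists_isCycle_of_labelling hg hlab
  exact hne (hqe _ ((hG.2.2 _ _ p q hp hq _).1 he))

end BridgedCycle

namespace BridgedCycle

section Fork

variable {V : Type*} {G : SimpleGraph V} {g : ℕ} {vc : ZMod g → V}

/-- `y` is a child of `x` when the component of `v_i` in `G - E(C)` is rooted at `v_i`. -/
def IsChild (G : SimpleGraph V) (g : ℕ) (vc : ZMod g → V) (i : ZMod g) (x y : V) : Prop :=
  (offCycle G g vc).Adj x y ∧ G.dist (vc i) y = G.dist (vc i) x + 1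

theorem exists_parent (h : BridgedCycle G g vc) {i : ZMod g} {u : V} (hu : inTree G g vc i u)
    (hne : u ≠ vc i) : ∃ w, IsChild G g vc i w u := by
  obtain ⟨p, hp⟩ := h.conn.exists_walk_length_eq_dist u (vc i)
  cases p with
  | nil => exact absurd rfl hne
  | @cons _ w _ hab q =>
    rw [Walk.length_cons] at hp
    have h1 := dist_le q
    have h2 : G.dist u (vc i) ≤ G.dist u w + G.dist w (vc i) := h.conn.dist_triangle
    rw [dist_eq_one_iff_adj.2 hab] at h2
    refine ⟨w, offCycle_adj.2 ⟨hab.symm, ?_⟩, by rw [dist_comm, dist_comm (v := w)]; omega⟩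
    rintro ⟨k, hk⟩
    rcases Sym2.eq_iff.1 hk with ⟨-, rfl⟩ | ⟨-, rfl⟩
    · exact hne (by rw [h.inTree_unique hu (inTree_self _)])
    · exact hne (by rw [h.inTree_unique hu (inTree_self _)])

theorem IsChild.bridge {i : ZMod g} {x y : V} (hxy : IsChild G g vc i x y)
    (h : BridgedCycle G g vc) : MetricBridge G x y :=
  h.bridge x y hxy.1

theorem IsChild.ne_cycle {i : ZMod g} {x y : V} (hxy : IsChild G g vc i x y)
    (h : BridgedCycle G g vc) (k : ZMod g) : y ≠ vc k := by
  rintro rfl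
  have := h.same_side hxy.1 i k hxy.2
  simp at this

theorem IsChild.isChild_of_adj {i : ZMod g} {x y c : V} (hxy : IsChild G g vc i x y)
    (h : BridgedCycle G g vc) (hc : G.Adj y c) (hne : c ≠ x) : IsChild G g vc i y c := by
  refine ⟨offCycle_adj.2 ⟨hc, ?_⟩, ?_⟩
  · rintro ⟨k, hk⟩
    rcases Sym2.eq_iff.1 hk with ⟨rfl, -⟩ | ⟨rfl, -⟩
    · exact hxy.ne_cycle h _ rfl
    · exact hxy.ne_cycle h _ rfl
  · have hb := hxy.bridge h
    have h1 := hb.symm.side_of_adj h.conn hc (fun e => hne e.2)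
      (by rw [dist_eq_one_iff_adj.2 hb.adj.symm, dist_self])
    have h2 := hb.sep _ _ hxy.2 h1
    rw [dist_comm (u := c), dist_eq_one_iff_adj.2 hc] at h2
    have := hxy.2
    omega

theorem IsChild.parent_unique {i : ZMod g} {x x' y : V} (hxy : IsChild G g vc i x y)
    (hxy' : IsChild G g vc i x' y) (h : BridgedCycle G g vc) : x = x' := by
  by_contra hne
  have h1 := (hxy.isChild_of_adj h (hxy'.bridge h).adj.symm (Ne.symm hne)).2
  have h2 := hxy'.2
  omega

/-- The vertices beyond a grandchild edge are beyond the child edge. -/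
theorem IsChild.beyond_trans {i : ZMod g} {x y c m : V} (hxy : IsChild G g vc i x y)
    (hyc : IsChild G g vc i y c) (h : BridgedCycle G g vc)
    (hm : G.dist m y = G.dist m c + 1) : G.dist m x = G.dist m y + 1 := by
  refine ((hxy.bridge h).side m).resolve_left fun h1 => ?_
  have h2 := hyc.2
  have h3 := hxy.2
  have h4 : G.dist c x = G.dist c y + 1 := by
    refine ((hxy.bridge h).side c).resolve_left fun h5 => ?_
    have := (hxy.bridge h).symm.sep y c
      (by rw [dist_eq_one_iff_adj.2 (hxy.bridge h).adj.symm, dist_self]) h5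
    rw [dist_eq_one_iff_adj.2 (hyc.bridge h).adj] at this
    have h6 : G.dist c x = 0 := by omega
    rw [h.conn.dist_eq_zero_iff.1 h6] at h2
    omega
  have h7 := (hxy.bridge h).sep m c h1 h4
  rw [dist_comm (u := c), dist_eq_one_iff_adj.2 (hyc.bridge h).adj] at h7
  omega

theorem exists_fork (h : BridgedCycle G g vc) (i : ZMod g) (n : ℕ) :
    ∀ u v, inTree G g vc i u → inTree G g vc i v → G.dist (vc i) u = n →
      G.dist (vc i) v = n → u ≠ v →
      ∃ z z₁ z₂, IsChild G g vc i z z₁ ∧ IsChild G g vc i z z₂ ∧ z₁ ≠ z₂ ∧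
        G.dist u z = G.dist u z₁ + 1 ∧ G.dist v z = G.dist v z₂ + 1 := by
  induction n with
  | zero =>
    intro u v _ _ hu hv huv
    exact absurd ((h.conn.dist_eq_zero_iff.1 hu).symm.trans (h.conn.dist_eq_zero_iff.1 hv)) huv
  | succ n ih =>
    intro u v hu hv hdu hdv huv
    have hne : ∀ x, G.dist (vc i) x = n + 1 → x ≠ vc i := by
      rintro x hx rfl
      simp at hx
    obtain ⟨u', hu'⟩ := h.exists_parent hu (hne u hdu)
    obtain ⟨v', hv'⟩ := h.exists_parent hv (hne v hdv)
    by_cases he : u' = v'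
    · subst he
      refine ⟨u', u, v, hu', hv', huv, ?_, ?_⟩
      · rw [dist_self, dist_eq_one_iff_adj.2 (hu'.bridge h).adj.symm]
      · rw [dist_self, dist_eq_one_iff_adj.2 (hv'.bridge h).adj.symm]
    · have e1 := hu'.2
      have e2 := hv'.2
      obtain ⟨z, z₁, z₂, h1, h2, h12, hz1, hz2⟩ := ih u' v' (inTree_of_adj hu hu'.1.symm)
        (inTree_of_adj hv hv'.1.symm) (by omega) (by omega) he
      have e3 := h1.2
      have e4 := h2.2
      refine ⟨z, z₁, z₂, h1, h2, h12, ?_, ?_⟩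
      · refine (h1.bridge h).symm.side_of_adj h.conn (hu'.bridge h).adj ?_ hz1
        rintro ⟨rfl, rfl⟩
        omega
      · refine (h2.bridge h).symm.side_of_adj h.conn (hv'.bridge h).adj ?_ hz2
        rintro ⟨rfl, rfl⟩
        omega

/-- What lies beyond one child of `z` is not beyond another child. -/
theorem IsChild.not_beyond {i : ZMod g} {z z₁ z₂ y : V} (h1 : IsChild G g vc i z z₁)
    (h2 : IsChild G g vc i z z₂) (h12 : z₁ ≠ z₂) (h : BridgedCycle G g vc)
    (hy : G.dist y z = G.dist y z₂ + 1) : G.dist y z₁ = G.dist y z + 1 := by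
  have hz1 : G.dist z₁ z₂ = G.dist z₁ z + 1 := by
    refine (h2.bridge h).side_of_adj h.conn (h1.bridge h).adj (fun e => h12 e.2) ?_
    rw [dist_self, dist_eq_one_iff_adj.2 (h2.bridge h).adj]
  have := (h2.bridge h).sep z₁ y hz1 hy
  rw [dist_eq_one_iff_adj.2 (h1.bridge h).adj.symm, dist_comm] at this
  omega

theorem IsChild.dist_lt_dist {i : ZMod g} {z z₁ z₂ u v s : V} (h1 : IsChild G g vc i z z₁)
    (h2 : IsChild G g vc i z z₂) (h12 : z₁ ≠ z₂) (h : BridgedCycle G g vc)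
    (hu : G.dist u z = G.dist u z₁ + 1) (hv : G.dist v z = G.dist v z₂ + 1)
    (huv : G.dist (vc i) u = G.dist (vc i) v) (hs : G.dist s z = G.dist s z₁ + 1) :
    G.dist s u + 1 < G.dist s v := by
  have e1 := (h1.bridge h).sep _ _ h1.2 hu
  have e2 := (h2.bridge h).sep _ _ h2.2 hv
  have e3 := (h1.bridge h).symm.sep _ _ hs (h1.not_beyond h2 h12 h hv)
  have e4 : G.dist s u ≤ G.dist s z₁ + G.dist z₁ u := h.conn.dist_triangle
  rw [dist_comm (u := z₁)] at e4
  omega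

theorem IsChild.edgeDist_lt_edgeDist {i : ZMod g} {z z₁ z₂ x w x' w' s : V}
    (h1 : IsChild G g vc i z z₁) (h2 : IsChild G g vc i z z₂) (h12 : z₁ ≠ z₂)
    (h : BridgedCycle G g vc) (hw' : IsChild G g vc i w' x')
    (hx : G.dist x z = G.dist x z₁ + 1) (hx' : G.dist x' z = G.dist x' z₂ + 1)
    (hxx' : G.dist (vc i) x = G.dist (vc i) x') (hs : G.dist s z = G.dist s z₁ + 1) :
    edgeDist G s s(w, x) < edgeDist G s s(w', x') := by
  have e1 := h1.dist_lt_dist h2 h12 h hx hx' hxx' hs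
  have e2 : G.dist s x' ≤ G.dist s w' + G.dist w' x' := h.conn.dist_triangle
  rw [dist_eq_one_iff_adj.2 (hw'.bridge h).adj] at e2
  simp only [edgeDist, Sym2.lift_mk]
  omega

end Fork

section Threads

variable {V : Type*} [Fintype V] {G : SimpleGraph V} [DecidableRel G.Adj]
  {g : ℕ} {vc : ZMod g → V} {S : Set V}

theorem three_le_degree {x a b c : V} (ha : G.Adj x a) (hb : G.Adj x b) (hc : G.Adj x c)
    (hab : a ≠ b) (hbc : b ≠ c) (hac : a ≠ c) : 3 ≤ G.degree x := by
  classical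
  have : ({a, b, c} : Finset V) ⊆ G.neighborFinset x := by
    intro y hy
    simp only [Finset.mem_insert, Finset.mem_singleton] at hy
    rw [mem_neighborFinset]
    rcases hy with rfl | rfl | rfl <;> assumption
  have := Finset.card_le_card this
  rwa [Finset.card_eq_three.2 ⟨a, b, c, hab, hac, hbc, rfl⟩, card_neighborFinset_eq_degree] at this

theorem IsChild.three_le_degree {i : ZMod g} {z z₁ z₂ : V} (h1 : IsChild G g vc i z z₁)
    (h2 : IsChild G g vc i z z₂) (h12 : z₁ ≠ z₂) (h : BridgedCycle G g vc) :
    3 ≤ G.degree z := by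
  have key : ∃ w, G.Adj z w ∧ w ≠ z₁ ∧ w ≠ z₂ := by
    obtain ⟨k, hk⟩ := h.exists_inTree z
    by_cases hz : z = vc k
    · have hne : ∀ y, IsChild G g vc i z y → vc (k + 1) ≠ y := by
        rintro y hy rfl
        exact (offCycle_adj.1 hy.1).2 ⟨k, by rw [hz]⟩
      exact ⟨vc (k + 1), hz ▸ h.lab.2 k, hne _ h1, hne _ h2⟩
    · obtain ⟨w, hw⟩ := h.exists_parent hk hz
      have hne : ∀ y, IsChild G g vc i z y → w ≠ y := by
        rintro y hy rfl
        have := h.same_side hy.1 i k hy.2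
        have := hw.2
        omega
      exact ⟨w, (hw.bridge h).adj.symm, hne _ h1, hne _ h2⟩
  obtain ⟨w, hw, hw1, hw2⟩ := key
  exact BridgedCycle.three_le_degree hw (h1.bridge h).adj (h2.bridge h).adj hw1 h12 hw2

/-- `t` is a list satisfying the requirements of a thread starting with the child `y` of `x`,
all of whose vertices lie beyond the edge `xy`. -/
structure IsTail (G : SimpleGraph V) [DecidableRel G.Adj] (x y : V) (t : List V) : Prop where
  nodup : (y :: t).Nodup
  chain : (y :: t).IsChain G.Adj
  last : ∀ u ∈ (y :: t).getLast?, G.degree u = 1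
  inner : ∀ u ∈ (y :: t).dropLast, G.degree u = 2
  beyond : ∀ m ∈ y :: t, G.dist m x = G.dist m y + 1

theorem IsTail.isThreadAt {x y : V} {t : List V} (ht : IsTail G x y t) (hxy : G.Adj x y)
    (hx : 3 ≤ G.degree x) : IsThreadAt G x (y :: t) := by
  refine ⟨List.cons_ne_nil _ _, ht.nodup, fun hmem => ?_, hx, ht.chain, ?_, ht.last, ht.inner⟩
  · have := ht.beyond x hmem
    simp at this
  · intro u hu
    simp only [List.head?_cons, Option.mem_def, Option.some.injEq] at hu
    exact hu ▸ hxy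

theorem IsTail.false_of_free {x y y' : V} {t t' : List V} (hbr : BranchResolving G S)
    (ht : IsTail G x y t) (ht' : IsTail G x y' t') (hxy : G.Adj x y) (hxy' : G.Adj x y')
    (hne : y ≠ y') (hx : 3 ≤ G.degree x) (hS : ∀ s ∈ S, G.dist s x ≠ G.dist s y + 1)
    (hS' : ∀ s ∈ S, G.dist s x ≠ G.dist s y' + 1) : False := by
  rcases hbr x _ _ (ht.isThreadAt hxy hx) (ht'.isThreadAt hxy' hx)
    (fun e => hne (List.cons.inj e).1) with ⟨s, hs, hst⟩ | ⟨s, hs, hst⟩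
  · exact hS s hs (ht.beyond s hst)
  · exact hS' s hs (ht'.beyond s hst)

theorem exists_isTail (h : BridgedCycle G g vc) (hbr : BranchResolving G S) (i : ZMod g) {M : ℕ}
    (hM : ∀ x, G.dist (vc i) x < M) (k : ℕ) :
    ∀ x y, IsChild G g vc i x y → (∀ s ∈ S, G.dist s x ≠ G.dist s y + 1) →
      M ≤ G.dist (vc i) y + k → ∃ t, IsTail G x y t := by
  induction k with
  | zero =>
    intro x y _ _ hk
    have := hM y
    omega
  | succ k ih =>
    intro x y hxy hS hk
    have hyx : G.dist y x = G.dist y y + 1 := by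
      rw [dist_self, dist_eq_one_iff_adj.2 (hxy.bridge h).adj.symm]
    have hrec : ∀ c, G.Adj y c → c ≠ x →
        IsChild G g vc i y c ∧ (∀ s ∈ S, G.dist s y ≠ G.dist s c + 1) ∧
          ∃ t, IsTail G y c t := by
      intro c hc hne
      have hyc := hxy.isChild_of_adj h hc hne
      have hS' : ∀ s ∈ S, G.dist s y ≠ G.dist s c + 1 := fun s hs e =>
        hS s hs (hxy.beyond_trans hyc h e)
      refine ⟨hyc, hS', ih y c hyc hS' ?_⟩
      have := hyc.2
      omega
    by_cases hex : ∃ c, G.Adj y c ∧ c ≠ x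
    · obtain ⟨c, hc, hcx⟩ := hex
      obtain ⟨hyc, hSc, t, ht⟩ := hrec c hc hcx
      have huniq : ∀ c', G.Adj y c' → c' = x ∨ c' = c := by
        intro c' hc'
        by_contra! hne
        obtain ⟨hyc', hSc', t', ht'⟩ := hrec c' hc' hne.1
        exact ht.false_of_free hbr ht' hc hc' hne.2.symm
          (hyc.three_le_degree hyc' hne.2.symm h) hSc hSc'
      have hdeg : G.degree y = 2 := by
        classical
        rw [← card_neighborFinset_eq_degree, Finset.card_eq_two]
        refine ⟨x, c, hcx.symm, ?_⟩
        ext a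
        rw [mem_neighborFinset, Finset.mem_insert, Finset.mem_singleton]
        refine ⟨huniq a, ?_⟩
        rintro (rfl | rfl)
        exacts [(hxy.bridge h).adj.symm, hc]
      refine ⟨c :: t, ?_, ?_, ?_, ?_, ?_⟩
      · refine List.nodup_cons.2 ⟨fun hmem => ?_, ht.nodup⟩
        have := ht.beyond y hmem
        simp at this
      · exact List.isChain_cons_cons.2 ⟨hc, ht.chain⟩
      · intro u hu
        rw [List.getLast?_cons_cons] at hu
        exact ht.last u hu
      · intro u hu
        rw [List.dropLast_cons_cons, List.mem_cons] at hu
        rcases hu with rfl | hu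
        exacts [hdeg, ht.inner u hu]
      · intro m hm
        rcases List.mem_cons.1 hm with rfl | hm
        exacts [hyx, hxy.beyond_trans hyc h (ht.beyond m hm)]
    · push Not at hex
      have hdeg : G.degree y = 1 := by
        rw [← card_neighborFinset_eq_degree, Finset.card_eq_one]
        refine ⟨x, ?_⟩
        ext a
        rw [mem_neighborFinset, Finset.mem_singleton]
        refine ⟨hex a, ?_⟩
        rintro rfl
        exact (hxy.bridge h).adj.symm
      refine ⟨[], by simp, by simp, by simpa using hdeg, by simp, ?_⟩
      intro m hm
      rw [List.mem_singleton] at hm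
      exact hm ▸ hyx

theorem exists_mem_beyond (h : BridgedCycle G g vc) (hbr : BranchResolving G S) {i : ZMod g}
    {z z₁ z₂ : V} (h1 : IsChild G g vc i z z₁) (h2 : IsChild G g vc i z z₂) (h12 : z₁ ≠ z₂) :
    (∃ s ∈ S, G.dist s z = G.dist s z₁ + 1) ∨ ∃ s ∈ S, G.dist s z = G.dist s z₂ + 1 := by
  by_contra! hS
  obtain ⟨M, hM⟩ : ∃ M, ∀ x, G.dist (vc i) x < M := by
    refine ⟨Finset.univ.sup (G.dist (vc i)) + 1, fun x => Nat.lt_succ_of_le ?_⟩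
    exact Finset.le_sup (f := G.dist (vc i)) (Finset.mem_univ x)
  obtain ⟨t, ht⟩ := h.exists_isTail hbr i hM M z z₁ h1 hS.1 (by omega)
  obtain ⟨t', ht'⟩ := h.exists_isTail hbr i hM M z z₂ h2 hS.2 (by omega)
  exact ht.false_of_free hbr ht' (h1.bridge h).adj (h2.bridge h).adj h12
    (h1.three_le_degree h2 h12 h) hS.1 hS.2

theorem exists_dist_ne (h : BridgedCycle G g vc) (hbr : BranchResolving G S) {i : ZMod g}
    {u v : V} (hu : inTree G g vc i u) (hv : inTree G g vc i v)
    (huv : G.dist (vc i) u = G.dist (vc i) v) (hne : u ≠ v) :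
    ∃ s ∈ S, G.dist s u ≠ G.dist s v := by
  obtain ⟨z, z₁, z₂, h1, h2, h12, hzu, hzv⟩ := h.exists_fork i _ u v hu hv huv rfl hne
  rcases h.exists_mem_beyond hbr h1 h2 h12 with ⟨s, hs, hsz⟩ | ⟨s, hs, hsz⟩
  · have := h1.dist_lt_dist h2 h12 h hzu hzv huv hsz
    exact ⟨s, hs, by omega⟩
  · have := h2.dist_lt_dist h1 h12.symm h hzv hzu huv.symm hsz
    exact ⟨s, hs, by omega⟩

theorem exists_edgeDist_ne (h : BridgedCycle G g vc) (hbr : BranchResolving G S) {i : ZMod g}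
    {w x w' x' : V} (hx : inTree G g vc i x) (hx' : inTree G g vc i x')
    (hw : IsChild G g vc i w x) (hw' : IsChild G g vc i w' x')
    (hww' : G.dist (vc i) w = G.dist (vc i) w') (hne : s(w, x) ≠ s(w', x')) :
    ∃ s ∈ S, edgeDist G s s(w, x) ≠ edgeDist G s s(w', x') := by
  have hxx' : G.dist (vc i) x = G.dist (vc i) x' := by rw [hw.2, hw'.2, hww']
  have hne' : x ≠ x' := by
    rintro rfl
    exact hne (by rw [hw.parent_unique hw' h])
  obtain ⟨z, z₁, z₂, h1, h2, h12, hz, hz'⟩ := h.exists_fork i _ x x' hx hx' hxx' rfl hne'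
  rcases h.exists_mem_beyond hbr h1 h2 h12 with ⟨s, hs, hsz⟩ | ⟨s, hs, hsz⟩
  · exact ⟨s, hs, (h1.edgeDist_lt_edgeDist h2 h12 h hw' hz hz' hxx' hsz).ne⟩
  · exact ⟨s, hs,
      (h2.edgeDist_lt_edgeDist h1 h12.symm h hw hz' hz hxx'.symm hsz).ne'⟩

end Threads

end BridgedCycle

section Placed

variable {V : Type*} {G : SimpleGraph V} {g : ℕ} {vc : ZMod g → V}

theorem cyc_two_mul (n a b : ℕ) : cyc (2 * n) (2 * a) (2 * b) = 2 * cyc n a b := by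
  unfold cyc
  omega

/-- `δ` is the distance function to an object (vertex: `ε = 0`, edge: `ε = 1`) which, after
subdividing every edge of `G` once, is attached at height `k` to the vertex in position `P` of
the subdivided cycle. -/
structure Placed (G : SimpleGraph V) (g : ℕ) (vc : ZMod g → V) (δ : V → ℕ) (ε P k : ℕ) :
    Prop where
  lt : P < 2 * g
  root : ∀ i : ZMod g, 2 * δ (vc i) + ε = cyc (2 * g) (2 * i.val) P + k
  lip : ∀ s t, δ s ≤ G.dist s t + δ t
  off : ∀ (i : ZMod g) (s : V), inTree G g vc i s → P ≠ 2 * i.val →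
    δ s = G.dist s (vc i) + δ (vc i)

namespace Placed

variable {δ δ' : V → ℕ} {ε P k P' k' : ℕ}

theorem root_eq_of_off (A : Placed G g vc δ ε P k) (B : Placed G g vc δ' ε P' k')
    {y : ZMod g} {s : V} (hs : inTree G g vc y s) (hδ : δ s = δ' s) (hP : P ≠ 2 * y.val)
    (hP' : P' ≠ 2 * y.val) : δ (vc y) = δ' (vc y) := by
  have h1 := A.off y s hs hP
  have h2 := B.off y s hs hP'
  omega

theorem root_eq_of_eq (h : BridgedCycle G g vc) (A : Placed G g vc δ ε P k)
    (B : Placed G g vc δ' ε P' k') {x y : ZMod g} {s : V} (hs : inTree G g vc x s)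
    (hδ : δ s = δ' s) (hP : P = 2 * x.val) (hP' : P' ≠ 2 * x.val)
    (hy : δ (vc y) = δ' (vc y)) : δ (vc x) = δ' (vc x) := by
  have h1 := A.root y
  have h2 := A.root x
  have h3 := B.lip (vc y) (vc x)
  have h4 := A.lip s (vc x)
  have h5 := B.off x s hs hP'
  rw [hP, cyc_two_mul, ← h.dist_cycle] at h1 h2
  rw [dist_self] at h2
  omega

theorem root_eq (h : BridgedCycle G g vc) (A : Placed G g vc δ ε P k)
    (B : Placed G g vc δ' ε P' k') (hne : P ≠ P') {x y : ZMod g} {s : V}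
    (hs : inTree G g vc x s) (hδ : δ s = δ' s) (hy : δ (vc y) = δ' (vc y)) :
    δ (vc x) = δ' (vc x) := by
  by_cases hP : P = 2 * x.val
  · exact root_eq_of_eq h A B hs hδ hP (hP ▸ hne.symm) hy
  by_cases hP' : P' = 2 * x.val
  · exact (root_eq_of_eq h B A hs hδ.symm hP' (hP' ▸ hne) hy.symm).symm
  · exact A.root_eq_of_off B hs hδ hP hP'

theorem eq_of_geodesic_triple (h : BridgedCycle G g vc) (A : Placed G g vc δ ε P k)
    (B : Placed G g vc δ' ε P' k') {i j l : ZMod g} (hij : i ≠ j) (hjl : j ≠ l) (hil : i ≠ l)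
    (ht : G.dist (vc i) (vc j) + G.dist (vc j) (vc l) + G.dist (vc i) (vc l) = g)
    {si sj sl : V} (hi : inTree G g vc i si) (hj : inTree G g vc j sj)
    (hl : inTree G g vc l sl) (ei : δ si = δ' si) (ej : δ sj = δ' sj) (el : δ sl = δ' sl) :
    P = P' ∧ k = k' := by
  have : NeZero g := ⟨by have := h.three_le; omega⟩
  have vij : i.val ≠ j.val := fun e => hij (ZMod.val_injective g e)
  have vjl : j.val ≠ l.val := fun e => hjl (ZMod.val_injective g e)
  have vil : i.val ≠ l.val := fun e => hil (ZMod.val_injective g e)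
  obtain ⟨y, hy⟩ : ∃ y, δ (vc y) = δ' (vc y) := by
    by_cases h1 : P = 2 * i.val ∨ P' = 2 * i.val
    · by_cases h2 : P = 2 * j.val ∨ P' = 2 * j.val
      · exact ⟨l, A.root_eq_of_off B hl el (by omega) (by omega)⟩
      · exact ⟨j, A.root_eq_of_off B hj ej (by omega) (by omega)⟩
    · exact ⟨i, A.root_eq_of_off B hi ei (by omega) (by omega)⟩
  have hP : P = P' := by
    by_contra hne
    have ri := root_eq h A B hne hi ei hy
    have rj := root_eq h A B hne hj ej hy
    have rl := root_eq h A B hne hl el hy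
    have ai := A.root i
    have aj := A.root j
    have al := A.root l
    rw [ri, B.root] at ai
    rw [rj, B.root] at aj
    rw [rl, B.root] at al
    have vi := ZMod.val_lt i
    have vj := ZMod.val_lt j
    have vl := ZMod.val_lt l
    rw [h.dist_cycle, h.dist_cycle, h.dist_cycle] at ht
    refine hne (eq_of_cyc_add_eq (n := 2 * g) (a := 2 * i.val) (b := 2 * j.val)
      (c := 2 * l.val) (by omega) (by omega) (by omega) (by omega) (by omega) (by omega)
      A.lt B.lt ?_ ai.symm aj.symm al.symm)
    rw [cyc_two_mul, cyc_two_mul, cyc_two_mul]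
    omega
  subst hP
  have h1 := A.root y
  have h2 := B.root y
  exact ⟨rfl, by omega⟩

end Placed

namespace BridgedCycle

theorem placed_vertex (h : BridgedCycle G g vc) {i : ZMod g} {u : V}
    (hu : inTree G g vc i u) :
    Placed G g vc (fun s => G.dist s u) 0 (2 * i.val) (2 * G.dist (vc i) u) where
  lt := by
    have : NeZero g := ⟨by have := h.three_le; omega⟩
    have := ZMod.val_lt i
    omega
  root j := by
    have h1 := h.dist_of_inTree hu j
    rw [dist_comm (u := u), dist_comm (u := u), h.dist_cycle, cyc_comm] at h1
    rw [cyc_two_mul]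
    omega
  lip s t := h.conn.dist_triangle
  off j s hs hne := h.dist_of_inTree_of_inTree (by rintro rfl; exact hne rfl) hs hu

theorem edgeDist_le (h : BridgedCycle G g vc) (e : Sym2 V) (s t : V) :
    edgeDist G s e ≤ G.dist s t + edgeDist G t e := by
  induction e with
  | _ a b =>
    have h1 : G.dist s a ≤ G.dist s t + G.dist t a := h.conn.dist_triangle
    have h2 : G.dist s b ≤ G.dist s t + G.dist t b := h.conn.dist_triangle
    simp only [edgeDist, Sym2.lift_mk]
    omega

theorem placed_treeEdge (h : BridgedCycle G g vc) {i : ZMod g} {w x : V}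
    (hw : inTree G g vc i w) (hx : inTree G g vc i x) (hwx : IsChild G g vc i w x) :
    Placed G g vc (fun s => edgeDist G s s(w, x)) 1 (2 * i.val)
      (2 * G.dist (vc i) w + 1) where
  lt := (h.placed_vertex hw).lt
  root j := by
    have h1 := (h.placed_vertex hw).root j
    have h2 := (h.placed_vertex hx).root j
    have h3 := hwx.2
    simp only [edgeDist, Sym2.lift_mk]
    omega
  lip := h.edgeDist_le _
  off j s hs hne := by
    have h1 := (h.placed_vertex hw).off j s hs hne
    have h2 := (h.placed_vertex hx).off j s hs hne
    simp only [edgeDist, Sym2.lift_mk]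
    omega

theorem placed_cycleEdge (h : BridgedCycle G g vc) (i : ZMod g) :
    Placed G g vc (fun s => edgeDist G s s(vc i, vc (i + 1))) 1 (2 * i.val + 1) 0 where
  lt := by
    have : NeZero g := ⟨by have := h.three_le; omega⟩
    have := ZMod.val_lt i
    omega
  root j := by
    have : NeZero g := ⟨by have := h.three_le; omega⟩
    have hi := ZMod.val_lt i
    have hj := ZMod.val_lt j
    have h1 := val_add_one h.three_le i
    simp only [edgeDist, Sym2.lift_mk, h.dist_cycle]
    unfold cyc
    omega
  lip := h.edgeDist_le _
  off j s hs _ := by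
    have h1 := h.dist_of_inTree hs i
    have h2 := h.dist_of_inTree hs (i + 1)
    simp only [edgeDist, Sym2.lift_mk]
    omega

theorem edge_cases (h : BridgedCycle G g vc) {e : Sym2 V} (he : e ∈ G.edgeSet) :
    (∃ i, e = s(vc i, vc (i + 1))) ∨
      ∃ i w x, e = s(w, x) ∧ inTree G g vc i w ∧ inTree G g vc i x ∧ IsChild G g vc i w x := by
  by_cases hc : e ∈ cycleEdges g vc
  · exact Or.inl hc
  · right
    induction e with
    | _ a b =>
      have hab : (offCycle G g vc).Adj a b := offCycle_adj.2 ⟨he, hc⟩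
      obtain ⟨i, hi⟩ := h.exists_inTree a
      have hib := inTree_of_adj hi hab
      rcases (h.bridge a b hab).side (vc i) with h1 | h1
      · exact ⟨i, a, b, rfl, hi, hib, hab, h1⟩
      · exact ⟨i, b, a, Sym2.eq_swap, hib, hi, hab.symm, h1⟩

end BridgedCycle

end Placed

theorem statement_2 {V : Type*} [Fintype V] [DecidableEq V] (G : SimpleGraph V)
    [DecidableRel G.Adj] (hG : IsUnicyclic G) (g : ℕ) (hg : 3 ≤ g)
    (vc : ZMod g → V) (hvc : IsCycleLabelling G g vc)
    (S : Set V) (hbr : BranchResolving G S) (ha : 3 ≤ aS G g vc S)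
    (htrip : ∃ i j l : ZMod g, i ≠ j ∧ j ≠ l ∧ i ≠ l ∧
      SActive G g vc S i ∧ SActive G g vc S j ∧ SActive G g vc S l ∧
      G.dist (vc i) (vc j) + G.dist (vc j) (vc l) + G.dist (vc i) (vc l) = g) :
    IsVertexMG G S ∧ IsEdgeMG G S := by
  have h := hG.bridgedCycle hg hvc
  have : NeZero g := ⟨by omega⟩
  obtain ⟨i, j, l, hij, hjl, hil, ⟨si, hSi, hi⟩, ⟨sj, hSj, hj⟩, ⟨sl, hSl, hl⟩, ht⟩ := htrip
  have key : ∀ {δ δ' : V → ℕ} {ε P k P' k' : ℕ}, Placed G g vc δ ε P k →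
      Placed G g vc δ' ε P' k' → (∀ s ∈ S, δ s = δ' s) → P = P' ∧ k = k' :=
    fun A B he => Placed.eq_of_geodesic_triple h A B hij hjl hil ht hi hj hl
      (he _ hSi) (he _ hSj) (he _ hSl)
  have hval : ∀ {a b : ZMod g}, a.val = b.val → a = b := fun e => ZMod.val_injective g e
  constructor
  · intro u v huv
    by_contra! he
    obtain ⟨a, hu⟩ := h.exists_inTree u
    obtain ⟨b, hv⟩ := h.exists_inTree v
    obtain ⟨hP, hk⟩ := key (h.placed_vertex hu) (h.placed_vertex hv) he
    obtain rfl : a = b := hval (by omega)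
    obtain ⟨s, hs, hne⟩ := h.exists_dist_ne hbr hu hv (by omega) huv
    exact hne (he s hs)
  · intro e he f hf hef
    by_contra! hd
    rcases h.edge_cases he with ⟨a, rfl⟩ | ⟨a, w, x, rfl, hw, hx, hwx⟩ <;>
      rcases h.edge_cases hf with ⟨b, rfl⟩ | ⟨b, w', x', rfl, hw', hx', hwx'⟩
    · have hP := (key (h.placed_cycleEdge a) (h.placed_cycleEdge b) hd).1
      exact hef (by rw [hval (a := a) (b := b) (by omega)])
    · have hP := (key (h.placed_cycleEdge a) (h.placed_treeEdge hw' hx' hwx') hd).1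
      omega
    · have hP := (key (h.placed_treeEdge hw hx hwx) (h.placed_cycleEdge b) hd).1
      omega
    · obtain ⟨hP, hk⟩ := key (h.placed_treeEdge hw hx hwx) (h.placed_treeEdge hw' hx' hwx') hd
      obtain rfl : a = b := hval (by omega)
      obtain ⟨s, hs, hne⟩ := h.exists_edgeDist_ne hbr hx hx' hwx hwx' (by omega) hef
      exact hne (hd s hs)
end

section
/- Let G be a unicyclic graph and let S be a biactive branch-resolving set in G, with the cycle C canonically labelled with respect to S. If G contains configuration A, configuration B, or configuration C with respect to S, then S is not a vertex metric generator of G. -/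
open SimpleGraph

section Helpers

variable {V : Type*} {G : SimpleGraph V} {g : ℕ} {vc : ZMod g → V}

/-- The distance between the positions `a, b < g` on a cycle of length `g`. -/
def cycDist (g a b : ℕ) : ℕ := min (a - b + (b - a)) (g - (a - b + (b - a)))

lemma IsCycleLabelling.natCast_inj (h : IsCycleLabelling G g vc) {a b : ℕ} (ha : a < g)
    (hb : b < g) (hab : vc a = vc b) : a = b := by
  have := (ZMod.natCast_eq_natCast_iff a b g).1 (h.1 hab)
  rwa [Nat.ModEq, Nat.mod_eq_of_lt ha, Nat.mod_eq_of_lt hb] at this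

lemma IsCycleLabelling.adj_natCast (h : IsCycleLabelling G g vc) (n : ℕ) :
    G.Adj (vc n) (vc (n + 1 : ℕ)) := by
  simpa using h.2 n

lemma IsCycleLabelling.reachable_natCast (h : IsCycleLabelling G g vc) (n : ℕ) :
    G.Reachable (vc 0) (vc n) := by
  induction n with
  | zero => simp
  | succ n ih => exact ih.trans (h.adj_natCast n).reachable

lemma IsCycleLabelling.reachable [NeZero g] (h : IsCycleLabelling G g vc) (i j : ZMod g) :
    G.Reachable (vc i) (vc j) := by
  have key : ∀ i, G.Reachable (vc 0) (vc i) := fun i => by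
    simpa using h.reachable_natCast i.val
  exact (key i).symm.trans (key j)

lemma IsCycleLabelling.exists_isCycle_s3 (h : IsCycleLabelling G g vc) (hg : 3 ≤ g) :
    ∃ (u : V) (p : G.Walk u u), p.IsCycle := by
  have key : ∀ n, n + 1 ≤ g →
      (G.deleteEdges {s(vc (0 : ℕ), vc (1 : ℕ))}).Reachable (vc (1 : ℕ)) (vc (n + 1 : ℕ)) := by
    intro n
    induction n with
    | zero => intro _; exact Reachable.refl _
    | succ n ih =>
      intro hn
      refine (ih (by omega)).trans (Adj.reachable ?_)
      rw [deleteEdges_adj]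
      refine ⟨h.adj_natCast (n + 1), ?_⟩
      simp only [Set.mem_singleton_iff, Sym2.eq_iff]
      rintro (⟨h1, -⟩ | ⟨h1, h2⟩)
      · have := h.natCast_inj (by omega) (by omega) h1
        omega
      · have := h.natCast_inj (by omega) (by omega) h1
        obtain rfl : n = 0 := by omega
        have := h.natCast_inj (by omega) (by omega) h2
        omega
  have h0 := key (g - 1) (by omega)
  rw [Nat.sub_add_cancel (by omega)] at h0
  have hg0 : vc (g : ℕ) = vc (0 : ℕ) := by simp
  rw [hg0] at h0
  obtain ⟨u, p, hp, -⟩ :=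
    adj_and_reachable_delete_edges_iff_exists_cycle.1 ⟨h.adj_natCast 0, h0.symm⟩
  exact ⟨u, p, hp⟩

lemma IsCycleLabelling.deleteEdges (h : IsCycleLabelling G g vc) {f : Sym2 V}
    (hf : f ∉ cycleEdges g vc) : IsCycleLabelling (G.deleteEdges {f}) g vc := by
  refine ⟨h.1, fun i => ?_⟩
  rw [deleteEdges_adj]
  exact ⟨h.2 i, fun hi => hf ⟨i, hi.symm⟩⟩

lemma IsUnicyclic.not_reachable_deleteEdges (hG : IsUnicyclic G) (h : IsCycleLabelling G g vc)
    (hg : 3 ≤ g) {x y : V} (hxy : (offCycle G g vc).Adj x y) :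
    ¬ (G.deleteEdges {s(x, y)}).Reachable x y := by
  intro hr
  rw [offCycle, deleteEdges_adj] at hxy
  obtain ⟨u, p, hp, hmem⟩ := adj_and_reachable_delete_edges_iff_exists_cycle.1 ⟨hxy.1, hr⟩
  obtain ⟨w, q, hq⟩ := (h.deleteEdges hxy.2).exists_isCycle_s3 hg
  have hle : G.deleteEdges {s(x, y)} ≤ G := deleteEdges_le _
  have := (hG.2.2 _ _ p (q.mapLe hle) hp (hq.mapLe hle) s(x, y)).1 hmem
  rw [Walk.edges_mapLe_eq_edges] at this
  have := q.edges_subset_edgeSet this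
  simp at this

lemma IsUnicyclic.inTree_injective (hG : IsUnicyclic G) (h : IsCycleLabelling G g vc)
    (hg : 3 ≤ g) {i j : ZMod g} (hij : inTree G g vc i (vc j)) : i = j := by
  have : NeZero g := ⟨by omega⟩
  by_contra hne
  obtain ⟨p, hp⟩ := Reachable.exists_isPath hij
  have hv : vc i ≠ vc j := fun he => hne (h.1 he)
  generalize hy : vc j = z at p hv
  cases p with
  | nil => exact hv rfl
  | @cons _ y _ hadj p =>
    subst hy
    rw [Walk.cons_isPath_iff] at hp
    apply hG.not_reachable_deleteEdges h hg hadj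
    have hf : s(vc i, y) ∉ p.edges := fun hm => hp.2 (p.fst_mem_support_of_mem_edges hm)
    have h1 : ((offCycle G g vc).deleteEdges {s(vc i, y)}).Reachable y (vc j) :=
      ⟨p.toDeleteEdge _ hf⟩
    have h2 : (G.deleteEdges {s(vc i, y)}).Reachable y (vc j) :=
      h1.mono (deleteEdges_mono (deleteEdges_le _))
    rw [offCycle, deleteEdges_adj] at hadj
    exact ((h.deleteEdges hadj.2).reachable i j).trans h2.symm

lemma IsUnicyclic.inTree_unique (hG : IsUnicyclic G) (h : IsCycleLabelling G g vc)
    (hg : 3 ≤ g) {i j : ZMod g} {x : V} (hi : inTree G g vc i x) (hj : inTree G g vc j x) :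
    i = j :=
  hG.inTree_injective h hg (Reachable.trans hi hj.symm)

lemma exists_inTree_of_walk {x y : V} (w : G.Walk x y) {j : ZMod g} (hy : inTree G g vc j y) :
    ∃ i, inTree G g vc i x := by
  induction w with
  | nil => exact ⟨j, hy⟩
  | @cons x z _ hadj _ ih =>
    obtain ⟨i, hi⟩ := ih hy
    by_cases hc : s(x, z) ∈ cycleEdges g vc
    · obtain ⟨a, ha⟩ := hc
      rcases Sym2.eq_iff.1 ha with ⟨rfl, -⟩ | ⟨rfl, -⟩
      · exact ⟨a, Reachable.refl _⟩
      · exact ⟨a + 1, Reachable.refl _⟩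
    · exact ⟨i, Reachable.trans hi
        (Adj.reachable (by rw [offCycle, deleteEdges_adj]; exact ⟨hadj, hc⟩)).symm⟩

lemma exists_natCast_inTree (hG : G.Connected) [NeZero g] (x : V) :
    ∃ a < g, inTree G g vc (a : ℕ) x := by
  obtain ⟨w⟩ := hG.preconnected x (vc 0)
  obtain ⟨i, hi⟩ := exists_inTree_of_walk w (Reachable.refl (vc 0))
  exact ⟨i.val, i.val_lt, by simpa using hi⟩

lemma IsUnicyclic.inTree_natCast_unique (hG : IsUnicyclic G) (h : IsCycleLabelling G g vc)
    (hg : 3 ≤ g) {a b : ℕ} {x : V} (ha : a < g) (hb : b < g)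
    (hi : inTree G g vc a x) (hj : inTree G g vc b x) : a = b :=
  h.natCast_inj ha hb (congrArg vc (hG.inTree_unique h hg hi hj))

lemma IsCycleLabelling.dist_le (h : IsCycleLabelling G g vc) (hG : G.Connected) (a n : ℕ) :
    G.dist (vc a) (vc (a + n : ℕ)) ≤ n := by
  induction n with
  | zero => simp
  | succ n ih =>
    have h1 := dist_eq_one_iff_adj.2 (h.adj_natCast (a + n))
    have h2 := hG.dist_triangle (u := vc a) (v := vc (a + n : ℕ)) (w := vc (a + n + 1 : ℕ))
    rw [← add_assoc]
    omega

lemma IsCycleLabelling.dist_le_cycDist (h : IsCycleLabelling G g vc) (hG : G.Connected)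
    {a b : ℕ} (ha : a < g) (hb : b < g) : G.dist (vc a) (vc b) ≤ cycDist g a b := by
  wlog hab : a ≤ b generalizing a b
  · have := this hb ha (by omega)
    rw [dist_comm]
    simp only [cycDist] at *
    omega
  have h1 := h.dist_le hG a (b - a)
  have h2 := h.dist_le hG b (a + g - b)
  rw [Nat.add_sub_cancel' (by omega)] at h1 h2
  have : vc (a + g : ℕ) = vc a := by simp
  rw [this, dist_comm] at h2
  simp only [cycDist]
  omega

lemma IsUnicyclic.add_cycDist_le_length (hG : IsUnicyclic G) (h : IsCycleLabelling G g vc)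
    (hg : 3 ≤ g) {b : ℕ} (hb : b < g) {x y : V} (w : G.Walk x y) (hy : y = vc b) {a : ℕ}
    (ha : a < g) (hx : inTree G g vc a x) :
    G.dist x (vc a) + cycDist g a b ≤ w.length := by
  have : NeZero g := ⟨by omega⟩
  induction w generalizing a with
  | nil =>
    subst hy
    obtain rfl := hG.inTree_natCast_unique h hg ha hb hx (Reachable.refl _)
    simp [cycDist]
  | @cons x z _ hadj p ih =>
    have ih := fun {c} => @ih hy c
    rw [Walk.length_cons]
    by_cases hc : s(x, z) ∈ cycleEdges g vc
    · obtain ⟨i, hi⟩ := hc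
      have hlt := i.val_lt
      obtain ⟨c, hc, hci⟩ : ∃ c < g, i + 1 = (c : ZMod g) :=
        ⟨(i + 1).val, (i + 1).val_lt, by simp⟩
      have hcv : c = i.val + 1 ∨ (c = 0 ∧ i.val + 1 = g) := by
        have h1 : (c : ZMod g) = ((i.val + 1 : ℕ) : ZMod g) := by simp [← hci]
        rw [ZMod.natCast_eq_natCast_iff, Nat.ModEq, Nat.mod_eq_of_lt hc] at h1
        rcases Nat.lt_or_ge (i.val + 1) g with h2 | h2
        · rw [Nat.mod_eq_of_lt h2] at h1; exact .inl h1
        · have h3 : i.val + 1 = g := by omega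
          rw [h3, Nat.mod_self] at h1; exact .inr ⟨h1, h3⟩
      have hiv : i = (i.val : ZMod g) := by simp
      rw [hci] at hi
      generalize i.val = d at *
      subst hiv
      rcases Sym2.eq_iff.1 hi with ⟨rfl, rfl⟩ | ⟨rfl, rfl⟩
      · obtain rfl := hG.inTree_natCast_unique h hg ha hlt hx (Reachable.refl _)
        have := ih hc (Reachable.refl _)
        simp only [SimpleGraph.dist_self, cycDist] at *
        omega
      · obtain rfl := hG.inTree_natCast_unique h hg ha hc hx (Reachable.refl _)
        have := ih hlt (Reachable.refl _)
        simp only [SimpleGraph.dist_self, cycDist] at *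
        omega
    · have hz : inTree G g vc a z := Reachable.trans hx
        (Adj.reachable (by rw [offCycle, deleteEdges_adj]; exact ⟨hadj, hc⟩))
      have h1 := ih ha hz
      have h2 := dist_eq_one_iff_adj.2 hadj
      have h3 := hG.1.dist_triangle (u := x) (v := z) (w := vc a)
      omega

lemma IsUnicyclic.dist_eq_add_cycDist (hG : IsUnicyclic G) (h : IsCycleLabelling G g vc)
    (hg : 3 ≤ g) {a b : ℕ} (ha : a < g) (hb : b < g) {x : V} (hx : inTree G g vc a x) :
    G.dist x (vc b) = G.dist x (vc a) + cycDist g a b := by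
  obtain ⟨w, hw⟩ := hG.1.exists_walk_length_eq_dist x (vc b)
  have h1 := hG.add_cycDist_le_length h hg hb w rfl ha hx
  have h2 := h.dist_le_cycDist hG.1 ha hb
  have h3 := hG.1.dist_triangle (u := x) (v := vc a) (w := vc b)
  omega

/-- A thread hanging at `v`, parametrised by the distance to `v`. -/
structure IsThreadMap (G : SimpleGraph V) (v : V) (t : List V) (f : ℕ → V) : Prop where
  zero : f 0 = v
  adj : ∀ n < t.length, G.Adj (f n) (f (n + 1))
  mem : ∀ n < t.length, f (n + 1) ∈ t
  eq_or_of_adj : ∀ n < t.length, ∀ y, G.Adj (f (n + 1)) y →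
    y = f n ∨ (n + 1 < t.length ∧ y = f (n + 2))

lemma IsThreadAt.exists_isThreadMap [Fintype V] [DecidableEq V] [DecidableRel G.Adj] {v : V}
    {t : List V} (h : IsThreadAt G v t) : ∃ f, IsThreadMap G v t f := by
  obtain ⟨hne, hnd, hv, -, hch, hhead, hlast, hdrop⟩ := h
  have hch : List.IsChain G.Adj (v :: t) := List.isChain_cons.2 ⟨hhead, hch⟩
  have hnd : (v :: t).Nodup := List.nodup_cons.2 ⟨hv, hnd⟩
  have hf : ∀ n (hn : n < t.length), (v :: t).getD (n + 1) v = t[n] := fun n hn => by simp [hn]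
  have hadj : ∀ n < t.length, G.Adj ((v :: t).getD n v) ((v :: t).getD (n + 1) v) := by
    intro n hn
    have := List.isChain_iff_getElem.1 hch n (by simpa using hn)
    rwa [List.getD_eq_getElem _ _ (by simp; omega), List.getD_eq_getElem _ _ (by simpa using hn)]
  refine ⟨fun n => (v :: t).getD n v, rfl, hadj, ?_, ?_⟩
  · intro n hn
    simp only [hf n hn]
    exact List.getElem_mem hn
  · intro n hn y hy
    have hprev := (hadj n hn).symm
    rcases Nat.lt_or_ge (n + 1) t.length with hn1 | hn1
    · have hdeg : G.degree ((v :: t).getD (n + 1) v) = 2 := by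
        rw [hf n hn]
        apply hdrop
        rw [List.mem_iff_getElem]
        exact ⟨n, by simp; omega, by simp⟩
      have hnext := hadj (n + 1) hn1
      have hne2 : (v :: t).getD n v ≠ (v :: t).getD (n + 1 + 1) v := by
        rw [List.getD_eq_getElem _ _ (by simp; omega), List.getD_eq_getElem _ _ (by simpa using hn1)]
        intro he
        have := (hnd.getElem_inj_iff).1 he
        omega
      have hs : ({(v :: t).getD n v, (v :: t).getD (n + 1 + 1) v} : Finset V) =
          G.neighborFinset ((v :: t).getD (n + 1) v) := by
        apply Finset.eq_of_subset_of_card_le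
        · intro z hz
          rw [mem_neighborFinset]
          rcases Finset.mem_insert.1 hz with rfl | hz
          · exact hprev
          · rw [Finset.mem_singleton.1 hz]; exact hnext
        · rw [card_neighborFinset_eq_degree, hdeg, Finset.card_pair hne2]
      have hy' := (mem_neighborFinset _ _ _).2 hy
      rw [← hs, Finset.mem_insert, Finset.mem_singleton] at hy'
      exact hy'.imp_right fun h => ⟨hn1, h⟩
    · left
      have hdeg : G.degree ((v :: t).getD (n + 1) v) = 1 := by
        rw [hf n hn]
        apply hlast
        obtain rfl : n = t.length - 1 := by omega
        simp [List.getLast?_eq_getElem?]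
      have hs : ({(v :: t).getD n v} : Finset V) =
          G.neighborFinset ((v :: t).getD (n + 1) v) := by
        apply Finset.eq_of_subset_of_card_le
        · intro z hz
          rw [mem_neighborFinset, Finset.mem_singleton.1 hz]
          exact hprev
        · rw [card_neighborFinset_eq_degree, hdeg, Finset.card_singleton]
      have hy' := (mem_neighborFinset _ _ _).2 hy
      rwa [← hs, Finset.mem_singleton] at hy'

namespace IsThreadMap

variable {v : V} {t : List V} {f : ℕ → V}

lemma notMem_range (hf : IsThreadMap G v t f) (h : IsCycleLabelling G g vc) (hg : 3 ≤ g)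
    {n : ℕ} (hn : n < t.length) : f (n + 1) ∉ Set.range vc := by
  intro hmem
  induction hd : t.length - n generalizing n with
  | zero => omega
  | succ d ih =>
    obtain ⟨i, hi⟩ := hmem
    have h1 := hf.eq_or_of_adj n hn (vc (i + 1)) (hi ▸ h.2 i)
    have h2 := hf.eq_or_of_adj n hn (vc (i - 1)) (hi ▸ by simpa using (h.2 (i - 1)).symm)
    have hne : vc (i + 1) ≠ vc (i - 1) := by
      intro he
      have h3 : ((2 : ℕ) : ZMod g) = ((0 : ℕ) : ZMod g) := by
        have := h.1 he
        push_cast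
        linear_combination this
      have := h.natCast_inj (by omega) (by omega) (congrArg vc h3)
      omega
    rcases h1 with h1 | ⟨h1, h1'⟩
    · rcases h2 with h2 | ⟨h2, h2'⟩
      · exact hne (h1.trans h2.symm)
      · exact ih h2 ⟨_, h2'⟩ (by omega)
    · exact ih h1 ⟨_, h1'⟩ (by omega)

lemma dist_le (hf : IsThreadMap G v t f) (hG : G.Connected) {n : ℕ} (hn : n ≤ t.length) :
    G.dist v (f n) ≤ n := by
  induction n with
  | zero => simp [hf.zero]
  | succ n ih =>
    have h1 := dist_eq_one_iff_adj.2 (hf.adj n hn)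
    have h2 := hG.dist_triangle (u := v) (v := f n) (w := f (n + 1))
    have h3 := ih (by omega)
    omega

lemma add_dist_le_length (hf : IsThreadMap G v t f) {x s : V}
    (w : G.Walk x s) (hs : s ∉ t) {n : ℕ} (hn : n < t.length) (hx : x = f (n + 1)) :
    n + 1 + G.dist v s ≤ w.length := by
  induction w generalizing n with
  | nil => exact absurd (hx ▸ hf.mem n hn) hs
  | @cons x z s hadj p ih =>
    rw [Walk.length_cons]
    rcases hf.eq_or_of_adj n hn z (hx ▸ hadj) with hz | ⟨hn1, hz⟩
    · rcases n with _ | n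
      · rw [hf.zero] at hz
        subst hz
        have := SimpleGraph.dist_le p
        omega
      · have := ih hs (by omega) hz
        omega
    · have := ih hs hn1 hz
      omega

lemma dist_eq (hf : IsThreadMap G v t f) (hG : G.Connected) {s : V} (hs : s ∉ t) {n : ℕ}
    (hn : n ≤ t.length) : G.dist s (f n) = G.dist s v + n := by
  rcases n with _ | n
  · simp [hf.zero]
  obtain ⟨w, hw⟩ := hG.exists_walk_length_eq_dist (f (n + 1)) s
  have h1 := hf.add_dist_le_length w hs hn rfl
  have h2 := hf.dist_le hG hn
  have h3 := hG.dist_triangle (u := s) (v := v) (w := f (n + 1))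
  rw [dist_comm (u := v) (v := s), hw, dist_comm (v := s)] at h1
  omega

end IsThreadMap

lemma SActive.le_kOf {S : Set V} {a : ℕ} (ha : a < g) (h : SActive G g vc S a) :
    a ≤ kOf G g vc S :=
  le_csSup ⟨g, fun _ hn => hn.1.le⟩ ⟨ha, h⟩

lemma kOf_mem {S : Set V} (hg : 0 < g) (h : SActive G g vc S 0) :
    kOf G g vc S < g ∧ SActive G g vc S (kOf G g vc S : ℕ) :=
  Nat.sSup_mem (s := {n : ℕ | n < g ∧ SActive G g vc S (n : ZMod g)}) ⟨0, hg, by simpa using h⟩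
    ⟨g, fun _ hn => hn.1.le⟩

lemma SActive.eq_zero_or_eq_kOf {S : Set V} (h : IsCycleLabelling G g vc)
    (h0 : SActive G g vc S 0) (h2 : aS G g vc S = 2) {a : ℕ} (ha : a < g)
    (hact : SActive G g vc S a) : a = 0 ∨ a = kOf G g vc S := by
  have : NeZero g := ⟨by omega⟩
  have hk := kOf_mem (by omega) h0
  by_contra! hne
  have hle := hact.le_kOf ha
  have hsub : ({((0 : ℕ) : ZMod g), (a : ZMod g), (kOf G g vc S : ZMod g)} : Set (ZMod g)) ⊆
      {i | SActive G g vc S i} := by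
    rintro i (rfl | rfl | rfl)
    · simpa using h0
    · exact hact
    · exact hk.2
  have h3 := Set.ncard_le_ncard hsub (Set.toFinite _)
  rw [Set.ncard_eq_three.2 ⟨_, _, _, ?_, ?_, ?_, rfl⟩] at h3
  · rw [aS] at h2
    omega
  · exact fun he => hne.1 (h.natCast_inj (by omega) ha (congrArg vc he)).symm
  · intro he
    have := h.natCast_inj (by omega) hk.1 (congrArg vc he)
    omega
  · exact fun he => hne.2 (h.natCast_inj ha hk.1 (congrArg vc he))

end Helpers

theorem statement_3 {V : Type*} [Fintype V] [DecidableEq V] (G : SimpleGraph V)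
    [DecidableRel G.Adj] (hG : IsUnicyclic G) (g : ℕ) (hg : 3 ≤ g)
    (vc : ZMod g → V) (hvc : IsCycleLabelling G g vc)
    (S : Set V) (hbr : BranchResolving G S) (hbi : Biactive G g vc S)
    (hcan : Canonical G g vc S)
    (hconf : ConfigA G g vc S ∨ ConfigB G g vc S ∨ ConfigC G g vc S) :
    ¬ IsVertexMG G S := by
  have : NeZero g := ⟨by omega⟩
  have h0 := hcan.2.1
  have hk := kOf_mem (by omega) h0
  have hroot : ∀ s ∈ S, ∃ a < g, inTree G g vc (a : ℕ) s ∧ SActive G g vc S (a : ℕ) := by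
    intro s hs
    obtain ⟨a, ha, hsa⟩ := exists_natCast_inTree (vc := vc) hG.1 s
    exact ⟨a, ha, hsa, s, hs, hsa⟩
  have hdist : ∀ {a b : ℕ} {s : V}, a < g → b < g → inTree G g vc a s →
      G.dist s (vc b) = G.dist s (vc a) + cycDist g a b :=
    fun ha hb hs => hG.dist_eq_add_cycDist hvc hg ha hb hs
  intro hgen
  have hA : aS G g vc S = 2 → Even g → kOf G g vc S ≠ g / 2 := by
    rintro h2 ⟨m, rfl⟩ hkm
    obtain ⟨s, hs, hne⟩ := hgen (vc (1 : ℕ)) (vc (m + m - 1 : ℕ)) fun he => by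
      have := hvc.natCast_inj (by omega) (by omega) he
      omega
    obtain ⟨a, ha, hsa, hact⟩ := hroot s hs
    have hak := SActive.eq_zero_or_eq_kOf hvc h0 h2 ha hact
    apply hne
    rw [hdist (b := 1) ha (by omega) hsa, hdist (b := m + m - 1) ha (by omega) hsa,
      cycDist, cycDist]
    omega
  have hB : ∀ {i j n : ℕ} {t : List V}, i < g → j < g → 0 < n → n ≤ t.length →
      IsThreadAt G (vc (i : ZMod g)) t → SFree S t →
      (∀ a < g, SActive G g vc S (a : ℕ) → cycDist g a j = cycDist g a i + n) → False := by
    intro i j n t hi hj hn hnt ht hfree hij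
    obtain ⟨f, hf⟩ := ht.exists_isThreadMap
    obtain ⟨s, hs, hne⟩ := hgen (f n) (vc j) fun he =>
      hf.notMem_range hvc hg (n := n - 1) (by omega)
        ⟨_, by rw [Nat.sub_add_cancel (by omega)]; exact he.symm⟩
    obtain ⟨a, ha, hsa, hact⟩ := hroot s hs
    apply hne
    rw [hf.dist_eq hG.1 (fun h => hfree s h hs) hnt, hdist ha hi hsa, hdist ha hj hsa,
      hij a ha hact, add_assoc]
  rcases hconf with ⟨h2, heven, hkg⟩ | ⟨hkg, i, hi, t, ht, hfree⟩ |
    ⟨h2, heven, hkg, i, hi, t, ht, hfree, hlen⟩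
  · exact hA h2 heven hkg
  · have hlen : 1 ≤ t.length := List.length_pos_iff.2 ht.1
    have hig : i < g := by omega
    obtain ⟨j, hj, hij⟩ : ∃ j < g, ∀ a ≤ kOf G g vc S, cycDist g a j = cycDist g a i + 1 := by
      rcases hi with hi | hi | rfl
      · refine ⟨i + 1, by omega, fun a ha => ?_⟩
        simp only [cycDist]
        omega
      · refine ⟨i - 1, by omega, fun a ha => ?_⟩
        simp only [cycDist]
        omega
      · refine ⟨g - 1, by omega, fun a ha => ?_⟩
        simp only [cycDist]
        omega
    exact hB hig hj one_pos hlen ht hfree fun a ha hact => hij a (hact.le_kOf ha)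
  · have hkg' := hA h2 heven
    refine hB (j := g / 2 + kOf G g vc S - i) (by omega) (by omega) (by omega) hlen ht hfree
      fun a ha hact => ?_
    obtain ⟨m, rfl⟩ := heven
    rcases SActive.eq_zero_or_eq_kOf hvc h0 h2 ha hact with h | h
    all_goals
      rw [h, cycDist, cycDist]
      omega
end
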